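/- arXiv:2402.01085 — 2 statements merged into one kernel-verified Lean document; each statement's English description precedes it below -/
import Mathlib

section
/- For any complex n×n matrix X with ‖X‖ = 1, the two largest eigenvalues of the operator T_X(Y) = [X*,[X,Y]] satisfy λ₁(T_X) + λ₃(T_X) ≤ (4 + √10)/2, where λ₁ ≥ λ₂ ≥ … are the eigenvalues in decreasing order. -/
open Matrix

/-- The operator `T_X (Y) = [X*, [X, Y]]`. -/
noncomputable def TX {n : ℕ} (X Y : Matrix (Fin n) (Fin n) ℂ) : Matrix (Fin n) (Fin n) ℂ :=
  Xᴴ * (X * Y - Y * X) - (X * Y - Y * X) * Xᴴ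

/-- squared Frobenius norm -/
noncomputable def fn {n : ℕ} (A : Matrix (Fin n) (Fin n) ℂ) : ℝ :=
  ∑ i, ∑ j, Complex.normSq (A i j)

lemma trace_mul_ct {n : ℕ} (A : Matrix (Fin n) (Fin n) ℂ) :
    trace (A * Aᴴ) = (fn A : ℂ) := by
  simp only [fn, trace, Matrix.diag_apply, Matrix.mul_apply, Matrix.conjTranspose_apply]
  push_cast
  refine Finset.sum_congr rfl fun i _ => Finset.sum_congr rfl fun j _ => ?_
  exact Complex.mul_conj _

lemma fn_eq {n : ℕ} (A : Matrix (Fin n) (Fin n) ℂ) : fn A = (trace (A * Aᴴ)).re := by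
  rw [trace_mul_ct]; simp

lemma fn_nonneg {n : ℕ} (A : Matrix (Fin n) (Fin n) ℂ) : 0 ≤ fn A :=
  Finset.sum_nonneg fun _ _ => Finset.sum_nonneg fun _ _ => Complex.normSq_nonneg _

lemma fn_eq_zero {n : ℕ} {A : Matrix (Fin n) (Fin n) ℂ} (h : fn A = 0) : A = 0 := by
  unfold fn at h
  ext i j
  have h1 := (Finset.sum_eq_zero_iff_of_nonneg (fun i _ =>
    Finset.sum_nonneg fun j _ => Complex.normSq_nonneg (A i j))).mp h i (Finset.mem_univ _)
  have h2 := (Finset.sum_eq_zero_iff_of_nonneg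
    (fun j _ => Complex.normSq_nonneg (A i j))).mp h1 j (Finset.mem_univ _)
  exact Complex.normSq_eq_zero.mp h2

lemma fn_ct {n : ℕ} (A : Matrix (Fin n) (Fin n) ℂ) : fn Aᴴ = fn A := by
  unfold fn
  rw [Finset.sum_comm]
  simp [Matrix.conjTranspose_apply]

lemma fn_mul_left {n : ℕ} (U A : Matrix (Fin n) (Fin n) ℂ) (hU : Uᴴ * U = 1) :
    fn (U * A) = fn A := by
  rw [fn_eq, fn_eq, Matrix.conjTranspose_mul, Matrix.trace_mul_comm,
    Matrix.trace_mul_comm A, Matrix.mul_assoc, ← Matrix.mul_assoc Uᴴ, hU, Matrix.one_mul]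

lemma fn_mul_right {n : ℕ} (U A : Matrix (Fin n) (Fin n) ℂ) (hU : U * Uᴴ = 1) :
    fn (A * U) = fn A := by
  rw [fn_eq, fn_eq, Matrix.conjTranspose_mul, Matrix.mul_assoc, ← Matrix.mul_assoc U, hU,
    Matrix.one_mul]

lemma trace_comm_comm {n : ℕ} (X Y Z : Matrix (Fin n) (Fin n) ℂ) :
    trace ((X * Y - Y * X) * (X * Z - Z * X)ᴴ) = trace (TX X Y * Zᴴ) := by
  unfold TX
  generalize X * Y - Y * X = C
  rw [Matrix.conjTranspose_sub, Matrix.conjTranspose_mul, Matrix.conjTranspose_mul,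
    Matrix.mul_sub, Matrix.sub_mul, Matrix.trace_sub, Matrix.trace_sub]
  rw [Matrix.mul_assoc Xᴴ, Matrix.trace_mul_comm Xᴴ, Matrix.mul_assoc, Matrix.mul_assoc]

/-- spectral theorem -/
lemma spec {n : ℕ} (H : Matrix (Fin n) (Fin n) ℂ) (hH : H.IsHermitian) :
    ∃ (W : Matrix (Fin n) (Fin n) ℂ) (h : Fin n → ℝ), Wᴴ * W = 1 ∧ W * Wᴴ = 1 ∧
      H = W * diagonal (fun i => (h i : ℂ)) * Wᴴ := by
  have h1 := hH.spectral_theorem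
  refine ⟨hH.eigenvectorUnitary, hH.eigenvalues, ?_, ?_, ?_⟩
  · exact Unitary.coe_star_mul_self hH.eigenvectorUnitary
  · exact Unitary.coe_mul_star_self hH.eigenvectorUnitary
  · conv_lhs => rw [h1]
    rw [Unitary.conjStarAlgAut_apply]
    rfl

lemma svd {n : ℕ} (X : Matrix (Fin n) (Fin n) ℂ) :
    ∃ (U V : Matrix (Fin n) (Fin n) ℂ) (s : Fin n → ℝ), Uᴴ * U = 1 ∧ U * Uᴴ = 1 ∧
      Vᴴ * V = 1 ∧ V * Vᴴ = 1 ∧ (∀ i, 0 ≤ s i) ∧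
      X = U * diagonal (fun i => (s i : ℂ)) * Vᴴ := by
  obtain ⟨V, a, hV1, hV2, hVa⟩ := spec (Xᴴ * X) (Matrix.isHermitian_conjTranspose_mul_self X)
  set A := X * V with hA
  have hAA : Aᴴ * A = diagonal (fun i => (a i : ℂ)) := by
    rw [hA, Matrix.conjTranspose_mul, Matrix.mul_assoc, ← Matrix.mul_assoc Xᴴ, hVa]
    simp only [Matrix.mul_assoc]
    rw [hV1, Matrix.mul_one, ← Matrix.mul_assoc, hV1, Matrix.one_mul]
  have hin : ∀ i j, ∑ r, star (A r i) * A r j = if i = j then (a i : ℂ) else 0 := by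
    intro i j
    have := congrFun (congrFun hAA i) j
    simpa [Matrix.mul_apply, Matrix.diagonal_apply] using this
  have hapos : ∀ i, 0 ≤ a i := by
    intro i
    have h := hin i i
    simp only [if_true] at h
    have h2 : (∑ r, Complex.normSq (A r i) : ℝ) = a i := by
      apply Complex.ofReal_injective
      rw [← h]; push_cast
      refine Finset.sum_congr rfl fun r _ => ?_
      exact Complex.normSq_eq_conj_mul_self
    rw [← h2]; exact Finset.sum_nonneg fun _ _ => Complex.normSq_nonneg _
  let f : Fin n → EuclideanSpace ℂ (Fin n) := fun i =>
    WithLp.toLp 2 (fun r => A r i * ((Real.sqrt (a i))⁻¹ : ℝ))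
  have hf : Orthonormal ℂ (Set.domRestrict {i | a i ≠ 0} f) := by
    rw [orthonormal_iff_ite]
    rintro ⟨i, hi⟩ ⟨j, hj⟩
    have : inner ℂ (f i) (f j) = ((Real.sqrt (a i))⁻¹ : ℝ) * ((Real.sqrt (a j))⁻¹ : ℝ)
        * ∑ r, star (A r i) * A r j := by
      simp only [f, PiLp.inner_apply, Finset.mul_sum]
      refine Finset.sum_congr rfl fun r _ => ?_
      simp
      ring
    simp only [Set.domRestrict_apply, Subtype.mk.injEq]
    rw [this, hin]
    by_cases hij : i = j
    · subst hij
      simp only [if_true]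
      rw [← Complex.ofReal_mul, ← Complex.ofReal_mul, ← mul_inv, Real.mul_self_sqrt (hapos i),
        inv_mul_cancel₀ hi]; simp
    · simp [hij]
  obtain ⟨b, hb⟩ := hf.exists_orthonormalBasis_extension_of_card_eq (by simp)
  let U : Matrix (Fin n) (Fin n) ℂ := Matrix.of fun r i => b i r
  have hU1 : Uᴴ * U = 1 := by
    ext i j
    have := (orthonormal_iff_ite.mp b.orthonormal) i j
    simp only [PiLp.inner_apply] at this
    rw [Matrix.mul_apply, Matrix.one_apply, ← this]
    refine Finset.sum_congr rfl fun r _ => ?_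
    simp [mul_comm, U]
  have hU2 : U * Uᴴ = 1 := mul_eq_one_comm.mp hU1
  refine ⟨U, V, fun i => Real.sqrt (a i), hU1, hU2, hV1, hV2, fun i => Real.sqrt_nonneg _, ?_⟩
  have : A = U * diagonal (fun i => ((Real.sqrt (a i) : ℝ) : ℂ)) := by
    ext r i
    rw [Matrix.mul_diagonal]
    by_cases h0 : a i = 0
    · have h := hin i i
      simp only [if_true, h0] at h
      have h2 : (∑ r, Complex.normSq (A r i) : ℝ) = 0 := by
        apply Complex.ofReal_injective
        rw [← h]; push_cast
        refine Finset.sum_congr rfl fun r _ => ?_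
        exact Complex.normSq_eq_conj_mul_self
      rw [Finset.sum_eq_zero_iff_of_nonneg (fun _ _ => Complex.normSq_nonneg _)] at h2
      have := Complex.normSq_eq_zero.mp (h2 r (Finset.mem_univ _))
      simp [this, h0]
    · have hbi : b i = f i := hb i h0
      have : Real.sqrt (a i) ≠ 0 := Real.sqrt_ne_zero'.mpr (lt_of_le_of_ne (hapos i) (Ne.symm h0))
      simp only [U, Matrix.of_apply, hbi, f]
      have h' : ((Real.sqrt (a i) : ℝ) : ℂ) ≠ 0 := by exact_mod_cast this
      simp [h']
  rw [← this, hA, Matrix.mul_assoc, hV2, Matrix.mul_one]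

lemma fn_diag_mul {n : ℕ} (s : Fin n → ℝ) (A : Matrix (Fin n) (Fin n) ℂ) :
    fn (diagonal (fun i => (s i : ℂ)) * A) = ∑ i, ∑ j, s i ^ 2 * Complex.normSq (A i j) := by
  unfold fn
  refine Finset.sum_congr rfl fun i _ => Finset.sum_congr rfl fun j _ => ?_
  rw [Matrix.diagonal_mul, Complex.normSq_mul, Complex.normSq_ofReal]; ring

lemma fn_mul_diag {n : ℕ} (s : Fin n → ℝ) (A : Matrix (Fin n) (Fin n) ℂ) :
    fn (A * diagonal (fun i => (s i : ℂ))) = ∑ i, ∑ j, s j ^ 2 * Complex.normSq (A i j) := by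
  unfold fn
  refine Finset.sum_congr rfl fun i _ => Finset.sum_congr rfl fun j _ => ?_
  rw [Matrix.mul_diagonal, Complex.normSq_mul, Complex.normSq_ofReal]; ring

lemma fn_diag {n : ℕ} (s : Fin n → ℝ) :
    fn (diagonal (fun i => (s i : ℂ))) = ∑ i, s i ^ 2 := by
  have := fn_diag_mul s (1 : Matrix (Fin n) (Fin n) ℂ)
  rw [Matrix.mul_one] at this
  rw [this]
  refine Finset.sum_congr rfl fun i _ => ?_
  rw [Finset.sum_eq_single i]
  · simp
  · intro j _ hj; simp [hj.symm]
  · simp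

lemma fn_conj_diag {n : ℕ} {U V : Matrix (Fin n) (Fin n) ℂ} (s : Fin n → ℝ)
    (hU : Uᴴ * U = 1) (hV : Vᴴ * V = 1) :
    fn (U * diagonal (fun i => (s i : ℂ)) * Vᴴ) = ∑ i, s i ^ 2 := by
  rw [fn_mul_right _ _ (by simpa using hV), fn_mul_left _ _ hU, fn_diag]

/-- `‖XY‖² + ‖YX‖²` in singular coordinates -/
lemma M_form {n : ℕ} {U V X : Matrix (Fin n) (Fin n) ℂ} {s : Fin n → ℝ}
    (hU : Uᴴ * U = 1) (hU' : U * Uᴴ = 1) (hV : Vᴴ * V = 1) (hV' : V * Vᴴ = 1)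
    (hX : X = U * diagonal (fun i => (s i : ℂ)) * Vᴴ) (Y : Matrix (Fin n) (Fin n) ℂ) :
    fn (X * Y) + fn (Y * X) =
      ∑ i, ∑ j, (s i ^ 2 + s j ^ 2) * Complex.normSq ((Vᴴ * Y * U) i j) := by
  have h1 : fn (X * Y) = ∑ i, ∑ j, s i ^ 2 * Complex.normSq ((Vᴴ * Y * U) i j) := by
    rw [← fn_diag_mul, hX, Matrix.mul_assoc U, Matrix.mul_assoc U, fn_mul_left _ _ hU,
      ← fn_mul_right U _ hU']
    simp only [Matrix.mul_assoc]
  have h2 : fn (Y * X) = ∑ i, ∑ j, s j ^ 2 * Complex.normSq ((Vᴴ * Y * U) i j) := by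
    rw [← fn_mul_diag, hX, ← Matrix.mul_assoc, fn_mul_right _ _ (by simpa using hV),
      ← fn_mul_left Vᴴ _ (by simpa using hV')]
    simp only [Matrix.mul_assoc]
  rw [h1, h2]
  simp only [add_mul, Finset.sum_add_distrib]

lemma trace_HYHY {n : ℕ} {W H : Matrix (Fin n) (Fin n) ℂ} {h : Fin n → ℝ}
    (hH : H = W * diagonal (fun i => (h i : ℂ)) * Wᴴ) (Y : Matrix (Fin n) (Fin n) ℂ) :
    (trace (H * Y * (Hᴴ * Yᴴ))).re =
      ∑ i, ∑ j, h i * h j * Complex.normSq ((Wᴴ * Y * W) i j) := by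
  have hHH : Hᴴ = H := by
    rw [hH]
    simp only [Matrix.conjTranspose_mul, Matrix.conjTranspose_conjTranspose,
      Matrix.diagonal_conjTranspose, Matrix.mul_assoc]
    congr 3
    ext i; simp
  set Z := Wᴴ * Y * W with hZ
  have hZt : Zᴴ = Wᴴ * Yᴴ * W := by
    rw [hZ]; simp [Matrix.conjTranspose_mul, Matrix.mul_assoc]
  have : trace (H * Y * (Hᴴ * Yᴴ)) =
      trace ((diagonal (fun i => (h i : ℂ)) * Z) * (diagonal (fun i => (h i : ℂ)) * Zᴴ)) := by
    rw [hHH, hZt, hZ, hH]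
    simp only [Matrix.mul_assoc]
    rw [Matrix.trace_mul_comm]
    simp only [Matrix.mul_assoc]
  rw [this]
  simp only [trace, Matrix.diag_apply, Matrix.mul_apply (M := diagonal _ * Z),
    Matrix.diagonal_mul, Matrix.conjTranspose_apply, Complex.re_sum]
  refine Finset.sum_congr rfl fun i _ => Finset.sum_congr rfl fun j _ => ?_
  have : (h i : ℂ) * Z i j * ((h j : ℂ) * star (Z i j)) =
      ((h i * h j * Complex.normSq (Z i j) : ℝ) : ℂ) := by
    push_cast
    rw [← Complex.mul_conj]
    simp only [Complex.star_def]; ring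
  rw [this, Complex.ofReal_re]

lemma fn_sub {n : ℕ} (A B : Matrix (Fin n) (Fin n) ℂ) :
    fn (A - B) = fn A + fn B - 2 * (trace (A * Bᴴ)).re := by
  simp only [fn, trace, Matrix.diag_apply, Matrix.mul_apply, Matrix.conjTranspose_apply,
    Complex.re_sum, Finset.mul_sum, ← Finset.sum_add_distrib, ← Finset.sum_sub_distrib]
  refine Finset.sum_congr rfl fun i _ => Finset.sum_congr rfl fun j _ => ?_
  rw [Matrix.sub_apply, Complex.normSq_sub]; rfl

lemma decomp {n : ℕ} (X : Matrix (Fin n) (Fin n) ℂ) (hX1 : fn X = 1) :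
    ∃ (U V W W' : Matrix (Fin n) (Fin n) ℂ) (s h g : Fin n → ℝ),
      Uᴴ * U = 1 ∧ U * Uᴴ = 1 ∧ Vᴴ * V = 1 ∧ V * Vᴴ = 1 ∧ Wᴴ * W = 1 ∧ W * Wᴴ = 1 ∧
      W'ᴴ * W' = 1 ∧ W' * W'ᴴ = 1 ∧ (∀ i, 0 ≤ s i) ∧ ∑ i, s i ^ 2 = 1 ∧
      ∑ i, h i ^ 2 + ∑ i, g i ^ 2 = 1 ∧
      X = U * diagonal (fun i => (s i : ℂ)) * Vᴴ ∧
      ∀ Y, fn (X * Y - Y * X) =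
        ∑ i, ∑ j, (s i ^ 2 + s j ^ 2) * Complex.normSq ((Vᴴ * Y * U) i j)
        - 2 * ∑ i, ∑ j, h i * h j * Complex.normSq ((Wᴴ * Y * W) i j)
        - 2 * ∑ i, ∑ j, g i * g j * Complex.normSq ((W'ᴴ * Y * W') i j) := by
  obtain ⟨U, V, s, hU, hU', hV, hV', hs, hX⟩ := svd X
  set H : Matrix (Fin n) (Fin n) ℂ := (1 / 2 : ℂ) • (X + Xᴴ) with hHdef
  set G : Matrix (Fin n) (Fin n) ℂ := (-Complex.I / 2 : ℂ) • (X - Xᴴ) with hGdef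
  have hH : Hᴴ = H := by
    rw [hHdef, Matrix.conjTranspose_smul]
    simp [add_comm]
  have hG : Gᴴ = G := by
    ext i j
    simp [hGdef]
    ring
  have hXHG : X = H + Complex.I • G := by
    ext i j
    simp only [hHdef, hGdef, Matrix.add_apply, Matrix.smul_apply, Matrix.sub_apply, smul_eq_mul]
    linear_combination ((1:ℂ)/2 * (X i j - Xᴴ i j)) * Complex.I_sq
  clear_value H G
  obtain ⟨W, h, hW, hW', hWh⟩ := spec H hH
  obtain ⟨W', g, hWW, hWW', hWg⟩ := spec G hG
  have hfn : fn H + fn G = 1 := by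
    have e1 : fn X = fn H + fn G + 2 * (trace (H * (-(Complex.I • G))ᴴ)).re * (-1) := by
      have := fn_sub H (-(Complex.I • G))
      rw [sub_neg_eq_add, ← hXHG] at this
      rw [this]
      have : fn (-(Complex.I • G)) = fn G := by
        simp [fn]
      rw [this]; ring
    have e2 : (trace (H * (-(Complex.I • G))ᴴ)).re = 0 := by
      rw [Matrix.conjTranspose_neg, Matrix.conjTranspose_smul, hG]
      simp only [Complex.star_def, Complex.conj_I, neg_smul, neg_neg, Matrix.mul_smul,
        Matrix.trace_smul, smul_eq_mul]
      have : star (trace (H * G)) = trace (H * G) := by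
        rw [← Matrix.trace_conjTranspose, Matrix.conjTranspose_mul, hH, hG, Matrix.trace_mul_comm]
      have him : (trace (H * G)).im = 0 := Complex.conj_eq_iff_im.mp this
      simp [him]
    rw [e2] at e1
    linarith
  refine ⟨U, V, W, W', s, h, g, hU, hU', hV, hV', hW, hW', hWW, hWW', hs, ?_, ?_, hX, ?_⟩
  · rw [← hX1, hX, fn_conj_diag s hU hV]
  · rw [← hfn, hWh, hWg, fn_conj_diag _ hW hW, fn_conj_diag _ hWW hWW]
  · intro Y
    rw [fn_sub, M_form hU hU' hV hV' hX, ← trace_HYHY hWh, ← trace_HYHY hWg]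
    have key : (trace (X * Y * (Y * X)ᴴ)).re =
        (trace (H * Y * (Hᴴ * Yᴴ))).re + (trace (G * Y * (Gᴴ * Yᴴ))).re := by
      have hXt : Xᴴ = H - Complex.I • G := by
        rw [hXHG, Matrix.conjTranspose_add, Matrix.conjTranspose_smul, hH, hG]
        simp [sub_eq_add_neg]
      have hcross : (trace (G * Y * (H * Yᴴ))).im = 0 := by
        apply Complex.conj_eq_iff_im.mp
        change star _ = _
        rw [← Matrix.trace_conjTranspose]
        simp only [Matrix.conjTranspose_mul, Matrix.conjTranspose_conjTranspose, hH, hG]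
        rw [Matrix.trace_mul_comm (G * Y)]
        rw [Matrix.mul_assoc, Matrix.trace_mul_comm Y]
        simp only [Matrix.mul_assoc]
      have hcross2 : (trace (H * Y * (G * Yᴴ))).im = 0 := by
        apply Complex.conj_eq_iff_im.mp
        change star _ = _
        rw [← Matrix.trace_conjTranspose]
        simp only [Matrix.conjTranspose_mul, Matrix.conjTranspose_conjTranspose, hH, hG]
        rw [Matrix.trace_mul_comm (H * Y)]
        rw [Matrix.mul_assoc, Matrix.trace_mul_comm Y]
        simp only [Matrix.mul_assoc]
      have hexp : X * Y * (Y * X)ᴴ = H * Y * (H * Yᴴ) + G * Y * (G * Yᴴ)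
          + Complex.I • (G * Y * (H * Yᴴ)) - Complex.I • (H * Y * (G * Yᴴ)) := by
        rw [Matrix.conjTranspose_mul, hXt]
        conv_lhs => rw [hXHG]
        simp only [Matrix.add_mul, Matrix.sub_mul, Matrix.mul_sub, Matrix.smul_mul,
          Matrix.mul_smul, smul_add, smul_smul, Complex.I_mul_I, neg_smul, one_smul]
        abel
      rw [hexp, hH, hG]
      simp [Matrix.trace_add, Matrix.trace_sub, Matrix.trace_smul, hcross, hcross2]
    rw [key]
    ring

lemma sum_ind {n : ℕ} (a b : Fin n) (c : ℝ) :
    ∑ i, ∑ j, (if i = a ∧ j = b then c else 0) = c := by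
  rw [Finset.sum_eq_single a]
  · simp
  · intro i _ hi; simp [hi]
  · simp

/-- Bound for the negative part of `Y ↦ H Y H`. -/
lemma hweights {n : ℕ} [NeZero n] (h : Fin n → ℝ) (w : Fin n → Fin n → ℝ)
    (hw0 : ∀ i j, 0 ≤ w i j) (hw1 : ∀ i j, w i j ≤ 1) (κ L : ℝ) (hκ : 0 < κ)
    (hsum : ∑ i, ∑ j, w i j = 2 + κ)
    (hL : ∀ a b c : ℝ, 2 * b * (2 * a + κ * c) ≤ L * (a ^ 2 + b ^ 2 + c ^ 2)) :
    -(2 * ∑ i, ∑ j, h i * h j * w i j) ≤ L * ∑ i, h i ^ 2 := by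
  have hL0 : 0 ≤ L := by have := hL 1 0 0; norm_num at this; exact this
  have hS0 : 0 ≤ ∑ i, h i ^ 2 := Finset.sum_nonneg fun _ _ => sq_nonneg _
  obtain ⟨p, -, hp⟩ := Finset.exists_max_image Finset.univ h ⟨0, Finset.mem_univ _⟩
  obtain ⟨q, -, hq⟩ := Finset.exists_min_image Finset.univ h ⟨0, Finset.mem_univ _⟩
  have hp' : ∀ i, h i ≤ h p := fun i => hp i (Finset.mem_univ _)
  have hq' : ∀ i, h q ≤ h i := fun i => hq i (Finset.mem_univ _)
  by_cases hpos : 0 < h p ∧ h q < 0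
  swap
  · have : ∀ i j, 0 ≤ h i * h j := by
      intro i j
      rw [not_and_or, not_lt, not_lt] at hpos
      rcases hpos with h1 | h1
      · exact mul_nonneg_of_nonpos_of_nonpos ((hp' i).trans h1) ((hp' j).trans h1)
      · exact mul_nonneg (h1.trans (hq' i)) (h1.trans (hq' j))
    have h2 : 0 ≤ ∑ i, ∑ j, h i * h j * w i j :=
      Finset.sum_nonneg fun i _ => Finset.sum_nonneg fun j _ => mul_nonneg (this i j) (hw0 i j)
    have := mul_nonneg hL0 hS0
    linarith
  obtain ⟨ha, hb⟩ := hpos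
  have hpq : p ≠ q := by rintro rfl; linarith
  set S := ∑ i, h i ^ 2 with hS
  have hS2 : h p ^ 2 + h q ^ 2 ≤ S := by
    have := Finset.sum_le_sum_of_subset_of_nonneg (Finset.subset_univ ({p, q} : Finset (Fin n)))
      (f := fun i => h i ^ 2) (fun _ _ _ => sq_nonneg _)
    rwa [Finset.sum_pair hpq] at this
  have hS3 : ∀ r, r ≠ p → r ≠ q → h p ^ 2 + h q ^ 2 + h r ^ 2 ≤ S := by
    intro r hrp hrq
    have := Finset.sum_le_sum_of_subset_of_nonneg (Finset.subset_univ ({p, q, r} : Finset (Fin n)))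
      (f := fun i => h i ^ 2) (fun _ _ _ => sq_nonneg _)
    rw [Finset.sum_insert (by simp [hpq, hrp.symm]), Finset.sum_pair hrq.symm] at this
    linarith
  set a := h p with hadef
  set b := -h q with hbdef
  have hb0 : 0 < b := by linarith
  have hqb : h q = -b := by rw [hbdef]; ring
  obtain ⟨θ, hθ⟩ : ∃ θ, θ = min (a * b) ((L * S / 2 - 2 * (a * b)) / κ) := ⟨_, rfl⟩
  have hθ1 : θ ≤ a * b := hθ ▸ min_le_left _ _
  have hθ2 : κ * θ + 2 * (a * b) ≤ L * S / 2 := by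
    have : θ ≤ (L * S / 2 - 2 * (a * b)) / κ := hθ ▸ min_le_right _ _
    rw [le_div_iff₀ hκ] at this
    linarith
  have hle : ∀ z, z ≤ a * b → κ * z + 2 * (a * b) ≤ L * S / 2 → z ≤ θ := by
    intro z h1 h2
    rw [hθ]
    refine le_min h1 ?_
    rw [le_div_iff₀ hκ]; linarith
  have hθ0 : 0 ≤ θ := by
    apply hle 0 (by positivity)
    have h1 := hL a b 0
    have h2 := mul_le_mul_of_nonneg_left hS2 hL0
    rw [hqb] at h2
    nlinarith
  -- pairs with positive then negative entry
  have hone : ∀ i j, 0 < h i → h j < 0 → ¬ (i = p ∧ j = q) → -(h i * h j) ≤ θ := by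
    intro i j hi hj hne
    have hj' : -h j ≤ b := by have := hq' j; linarith
    have hi' := hp' i
    apply hle
    · nlinarith
    · by_cases hip : i = p
      · have hjq : j ≠ q := fun hh => hne ⟨hip, hh⟩
        have hjp : j ≠ p := by rintro rfl; linarith
        have h1 := hL b a (-h j)
        have h2 := mul_le_mul_of_nonneg_left (hS3 j hjp hjq) hL0
        rw [hqb] at h2
        have h3 : -(h i * h j) ≤ a * (-h j) := by nlinarith
        nlinarith
      · have hiq : i ≠ q := by rintro rfl; linarith
        have h1 := hL a b (h i)
        have h2 := mul_le_mul_of_nonneg_left (hS3 i hip hiq) hL0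
        rw [hqb] at h2
        have h3 : -(h i * h j) ≤ b * h i := by nlinarith
        nlinarith
  have hall : ∀ i j, ¬ (i = p ∧ j = q) → ¬ (i = q ∧ j = p) → -(h i * h j) ≤ θ := by
    intro i j h1 h2
    by_cases hn : 0 ≤ h i * h j
    · linarith
    · rw [not_le, mul_neg_iff] at hn
      rcases hn with ⟨hi, hj⟩ | ⟨hi, hj⟩
      · exact hone i j hi hj h1
      · rw [mul_comm]; exact hone j i hj hi (fun hh => h2 ⟨hh.2, hh.1⟩)
  have hpt : ∀ i j, -(h i * h j * w i j) ≤ θ * w i j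
      + (if i = p ∧ j = q then (a * b - θ) else 0) + (if i = q ∧ j = p then (a * b - θ) else 0) := by
    intro i j
    have w0 := hw0 i j
    have w1 := hw1 i j
    by_cases c1 : i = p ∧ j = q
    · have c2 : ¬ (i = q ∧ j = p) := fun hh => hpq (c1.1.symm.trans hh.1)
      rw [if_pos c1, if_neg c2]
      obtain ⟨rfl, rfl⟩ := c1
      rw [hqb]
      nlinarith
    · by_cases c2 : i = q ∧ j = p
      · rw [if_neg c1, if_pos c2]
        obtain ⟨rfl, rfl⟩ := c2
        rw [hqb]
        nlinarith
      · rw [if_neg c1, if_neg c2]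
        have := hall i j c1 c2
        nlinarith
  have hfin := Finset.sum_le_sum (s := Finset.univ) fun i _ =>
    Finset.sum_le_sum (s := Finset.univ) fun j _ => hpt i j
  simp only [Finset.sum_add_distrib, sum_ind, Finset.sum_neg_distrib, ← Finset.mul_sum] at hfin
  rw [hsum] at hfin
  linarith

lemma Mweights {n : ℕ} (a : Fin n → ℝ) (ha0 : ∀ i, 0 ≤ a i) (ha : ∑ i, a i = 1)
    (p q : Fin n) (hpq : p ≠ q) (hp : ∀ i, a i ≤ a p) (hq : ∀ i, i ≠ p → a i ≤ a q)
    (w : Fin n → Fin n → ℝ) (hw0 : ∀ i j, 0 ≤ w i j) (hw1 : ∀ i j, w i j ≤ 1) :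
    ∃ θ, θ ≤ max (2 * a q) (1 - a q) ∧ θ ≤ a p + a q ∧
      ∑ i, ∑ j, (a i + a j) * w i j ≤
        θ * (∑ i, ∑ j, w i j) + (2 * a p - θ) * w p p + 2 * (a p + a q - θ) := by
  refine ⟨min (max (2 * a q) (1 - a q)) (a p + a q), min_le_left _ _, min_le_right _ _, ?_⟩
  obtain ⟨θ, hθ⟩ : ∃ θ, θ = min (max (2 * a q) (1 - a q)) (a p + a q) := ⟨_, rfl⟩
  rw [← hθ]
  have hθ2 : θ ≤ a p + a q := hθ ▸ min_le_right _ _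
  have h3 : ∀ j, j ≠ p → j ≠ q → a p + a j ≤ θ := by
    intro j hjp hjq
    rw [hθ]
    refine le_min (le_trans ?_ (le_max_right _ _)) ?_
    · have := Finset.sum_le_sum_of_subset_of_nonneg
        (Finset.subset_univ ({p, q, j} : Finset (Fin n))) (f := a) (fun i _ _ => ha0 i)
      rw [Finset.sum_insert (by simp [hpq, hjp.symm]), Finset.sum_pair hjq.symm, ha] at this
      linarith
    · linarith [hq j hjp]
  have h2 : ∀ i j, i ≠ p → j ≠ p → a i + a j ≤ θ := by
    intro i j hi hj
    have e1 := hq i hi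
    have e2 := hq j hj
    rw [hθ]
    refine le_min (le_trans ?_ (le_max_left _ _)) ?_
    · linarith
    · linarith [hp q]
  have hpt : ∀ i j, (a i + a j) * w i j ≤ θ * w i j
      + (if i = p ∧ j = p then (2 * a p - θ) * w p p else 0)
      + (if i = p ∧ j = q then (a p + a q - θ) else 0)
      + (if i = q ∧ j = p then (a p + a q - θ) else 0) := by
    intro i j
    have w0 := hw0 i j
    have w1 := hw1 i j
    by_cases hi : i = p
    · subst hi
      by_cases hj : j = i
      · subst hj
        simp only [hpq, and_self, if_true, and_false, false_and, if_false]
        linarith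
      · by_cases hjq : j = q
        · subst hjq
          simp only [hpq, hpq.symm, and_self, if_true, and_false, if_false]
          nlinarith
        · simp only [hj, hjq, and_false, if_false]
          have := h3 j hj hjq
          nlinarith
    · by_cases hj : j = p
      · subst hj
        by_cases hiq : i = q
        · subst hiq
          simp only [hpq, hpq.symm, and_self, if_true, and_false, false_and, if_false]
          nlinarith
        · simp only [hi, hiq, false_and, if_false]
          have := h3 i hi hiq
          nlinarith
      · simp only [hi, hj, and_false, false_and, if_false]
        have := h2 i j hi hj
        nlinarith
  have hfin := Finset.sum_le_sum (s := Finset.univ) fun i _ =>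
    Finset.sum_le_sum (s := Finset.univ) fun j _ => hpt i j
  simp only [Finset.sum_add_distrib (f := fun _ => _ + _), sum_ind, ← Finset.mul_sum] at hfin
  have : ∀ i, ∑ j, (a i + a j) * w i j = ∑ j, (a i + a j) * w i j := fun _ => rfl
  simp only [Finset.sum_add_distrib, sum_ind, ← Finset.mul_sum] at hfin
  linarith

lemma tr_lin {n : ℕ} {ι κ : Type*} [Fintype ι] [Fintype κ] (F : ι → Matrix (Fin n) (Fin n) ℂ)
    (G : κ → Matrix (Fin n) (Fin n) ℂ) (c : ι → ℂ) (d : κ → ℂ) :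
    trace ((∑ k, c k • F k) * (∑ l, d l • G l)ᴴ) =
      ∑ k, ∑ l, c k * star (d l) * trace (F k * (G l)ᴴ) := by
  rw [Matrix.conjTranspose_sum, Finset.sum_mul, Matrix.trace_sum]
  refine Finset.sum_congr rfl fun k _ => ?_
  rw [Finset.mul_sum, Matrix.trace_sum]
  refine Finset.sum_congr rfl fun l _ => ?_
  rw [Matrix.conjTranspose_smul, Matrix.smul_mul, Matrix.mul_smul, Matrix.trace_smul,
    Matrix.trace_smul, smul_eq_mul, smul_eq_mul]
  ring

lemma fn_comb {n : ℕ} {ι : Type*} [Fintype ι] [DecidableEq ι] (F : ι → Matrix (Fin n) (Fin n) ℂ)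
    (hF : ∀ i j, trace (F i * (F j)ᴴ) = if i = j then 1 else 0) (c : ι → ℂ) :
    fn (∑ k, c k • F k) = ∑ k, Complex.normSq (c k) := by
  rw [fn_eq, tr_lin]
  simp only [hF]
  simp [Complex.normSq_apply]

lemma TX_sum {n : ℕ} {ι : Type*} [Fintype ι] (X : Matrix (Fin n) (Fin n) ℂ)
    (F : ι → Matrix (Fin n) (Fin n) ℂ) (c : ι → ℂ) :
    TX X (∑ k, c k • F k) = ∑ k, c k • TX X (F k) := by
  simp only [TX, Finset.mul_sum, Finset.sum_mul, Matrix.mul_sub, Matrix.sub_mul,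
    Matrix.mul_smul, Matrix.smul_mul, Finset.sum_sub_distrib, smul_sub]

lemma q_comb {n : ℕ} {ι : Type*} [Fintype ι] [DecidableEq ι] (X : Matrix (Fin n) (Fin n) ℂ)
    (F : ι → Matrix (Fin n) (Fin n) ℂ) (ν : ι → ℝ)
    (hF : ∀ i j, trace (F i * (F j)ᴴ) = if i = j then 1 else 0)
    (hν : ∀ i, TX X (F i) = (ν i : ℂ) • F i) (c : ι → ℂ) :
    fn (X * (∑ k, c k • F k) - (∑ k, c k • F k) * X) = ∑ k, Complex.normSq (c k) * ν k := by
  rw [fn_eq, trace_comm_comm, TX_sum]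
  simp only [hν, smul_smul]
  rw [tr_lin]
  simp only [hF]
  simp [Complex.normSq_apply]
  refine Finset.sum_congr rfl fun k _ => ?_
  ring

lemma J_eig {n : ℕ} (X Y : Matrix (Fin n) (Fin n) ℂ) (m : ℝ) (h : TX X Y = (m : ℂ) • Y) :
    TX X (X * Y - Y * X)ᴴ = (m : ℂ) • (X * Y - Y * X)ᴴ := by
  have h1 : X * (X * Y - Y * X)ᴴ - (X * Y - Y * X)ᴴ * X = -((m : ℂ) • Yᴴ) := by
    have := congrArg conjTranspose h
    rw [TX, Matrix.conjTranspose_sub, Matrix.conjTranspose_mul, Matrix.conjTranspose_mul,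
      Matrix.conjTranspose_conjTranspose, Matrix.conjTranspose_smul] at this
    rw [← neg_sub, this]
    simp
  rw [TX, h1]
  simp only [Matrix.conjTranspose_sub, Matrix.conjTranspose_mul, Matrix.mul_neg, Matrix.neg_mul,
    Matrix.mul_smul, Matrix.smul_mul, smul_sub]
  abel

lemma eig_orth {n : ℕ} (X Y Z : Matrix (Fin n) (Fin n) ℂ) (a b : ℝ) (hY : TX X Y = (a : ℂ) • Y)
    (hZ : TX X Z = (b : ℂ) • Z) (hab : a ≠ b) : trace (Y * Zᴴ) = 0 := by
  have h1 := trace_comm_comm X Y Z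
  have h2 := trace_comm_comm X Z Y
  rw [hY, Matrix.smul_mul, Matrix.trace_smul] at h1
  rw [hZ, Matrix.smul_mul, Matrix.trace_smul] at h2
  have key : ∀ A B : Matrix (Fin n) (Fin n) ℂ, trace (A * Bᴴ) = star (trace (B * Aᴴ)) := by
    intro A B
    rw [← Matrix.trace_conjTranspose, Matrix.conjTranspose_mul, Matrix.conjTranspose_conjTranspose]
  rw [key, h2, key Z Y] at h1
  simp only [smul_eq_mul, star_mul', star_star] at h1
  have h3 : star (b : ℂ) = b := Complex.conj_ofReal b
  rw [h3] at h1
  have h4 : ((b : ℂ) - a) * trace (Y * Zᴴ) = 0 := by linear_combination h1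
  rcases mul_eq_zero.mp h4 with h5 | h5
  · exact absurd (by exact_mod_cast (sub_eq_zero.mp h5).symm) hab
  · exact h5

lemma complete {n : ℕ} (V : Fin (n * n) → Matrix (Fin n) (Fin n) ℂ)
    (horth : ∀ i j, trace (V i * (V j)ᴴ) = if i = j then 1 else 0)
    (Z : Matrix (Fin n) (Fin n) ℂ) : ∃ c : Fin (n * n) → ℂ, Z = ∑ k, c k • V k := by
  have hli : LinearIndependent ℂ V := by
    rw [Fintype.linearIndependent_iff]
    intro g hg i
    have h1 := fn_comb V horth g
    rw [hg] at h1
    have h0 : fn (0 : Matrix (Fin n) (Fin n) ℂ) = 0 := by simp [fn]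
    rw [h0] at h1
    have := (Finset.sum_eq_zero_iff_of_nonneg (fun k _ => Complex.normSq_nonneg (g k))).mp
      h1.symm i (Finset.mem_univ _)
    exact Complex.normSq_eq_zero.mp this
  have hsp := hli.span_eq_top_of_card_eq_finrank' (by simp [Module.finrank_matrix])
  have hZ : Z ∈ Submodule.span ℂ (Set.range V) := by rw [hsp]; trivial
  obtain ⟨c, hc⟩ := (Submodule.mem_span_range_iff_exists_fun ℂ).mp hZ
  exact ⟨c, hc.symm⟩

lemma complete_zero {n : ℕ} (V : Fin (n * n) → Matrix (Fin n) (Fin n) ℂ)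
    (horth : ∀ i j, trace (V i * (V j)ᴴ) = if i = j then 1 else 0)
    (Z : Matrix (Fin n) (Fin n) ℂ) (hZ : ∀ j, trace (Z * (V j)ᴴ) = 0) : Z = 0 := by
  obtain ⟨c, hc⟩ := complete V horth Z
  apply fn_eq_zero
  rw [fn_eq]
  have : trace (Z * Zᴴ) = 0 := by
    nth_rewrite 2 [hc]
    rw [Matrix.conjTranspose_sum, Finset.mul_sum, Matrix.trace_sum]
    refine Finset.sum_eq_zero fun j _ => ?_
    rw [Matrix.conjTranspose_smul, Matrix.mul_smul, Matrix.trace_smul, hZ, smul_zero]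
  rw [this]; rfl

lemma tr_anti {n : ℕ} (X A B : Matrix (Fin n) (Fin n) ℂ) :
    trace ((X * A - A * X) * B) = -trace ((X * B - B * X) * A) := by
  rw [Matrix.sub_mul, Matrix.sub_mul, Matrix.trace_sub, Matrix.trace_sub,
    Matrix.trace_mul_comm (X * A) B, Matrix.mul_assoc A X B, Matrix.trace_mul_comm A (X * B),
    Matrix.mul_assoc B X A]
  ring

lemma pairing {n : ℕ} (X : Matrix (Fin n) (Fin n) ℂ)
    (μ : Fin (n * n) → ℝ) (hmono : Antitone μ)
    (V : Fin (n * n) → Matrix (Fin n) (Fin n) ℂ)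
    (horth : ∀ i j, trace (V i * (V j)ᴴ) = if i = j then 1 else 0)
    (heig : ∀ i, TX X (V i) = (μ i : ℂ) • V i)
    (m : ℕ) (hodd : Odd (m + 1)) (hm : m + 1 < n * n) (hpos : 0 < μ ⟨m, by omega⟩) :
    μ ⟨m, by omega⟩ ≤ μ ⟨m + 1, hm⟩ := by
  by_contra hlt
  rw [not_le] at hlt
  let e : Fin (m + 1) → Fin (n * n) := fun i => ⟨i, by omega⟩
  have he : ∀ i j, e i = e j ↔ i = j := by
    intro i j; simp [e, Fin.ext_iff]
  have hee : ∀ i, μ ⟨m, by omega⟩ ≤ μ (e i) := fun i => hmono (by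
    simp only [e, Fin.mk_le_mk]; omega)
  let M : Matrix (Fin (m + 1)) (Fin (m + 1)) ℂ :=
    fun i j => trace ((X * V (e i) - V (e i) * X) * V (e j))
  have hM : Mᵀ = -M := by
    ext i j
    exact tr_anti X (V (e j)) (V (e i))
  have hdet : M.det = 0 := by
    have h1 := Matrix.det_transpose M
    rw [hM, Matrix.det_neg, Fintype.card_fin, hodd.neg_one_pow] at h1
    have h2 : (2 : ℂ) * M.det = 0 := by linear_combination -h1
    simpa using h2
  obtain ⟨c, hc0, hc⟩ := Matrix.exists_vecMul_eq_zero_iff.mpr hdet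
  obtain ⟨Y, hY⟩ : ∃ Y, Y = ∑ k, c k • V (e k) := ⟨_, rfl⟩
  have hJ : (X * Y - Y * X)ᴴ = ∑ k, star (c k) • (X * V (e k) - V (e k) * X)ᴴ := by
    rw [hY, Finset.mul_sum, Finset.sum_mul, ← Finset.sum_sub_distrib, Matrix.conjTranspose_sum]
    refine Finset.sum_congr rfl fun k _ => ?_
    rw [← Matrix.conjTranspose_smul, Matrix.mul_smul, Matrix.smul_mul, smul_sub]
  have hZ : (X * Y - Y * X)ᴴ = 0 := by
    apply complete_zero V horth
    intro j
    rw [hJ, Finset.sum_mul, Matrix.trace_sum]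
    simp only [Matrix.smul_mul, Matrix.trace_smul]
    by_cases hj : (j : ℕ) < m + 1
    · have hej : e ⟨j, hj⟩ = j := rfl
      have h2 := congrFun hc ⟨j, hj⟩
      simp only [Matrix.vecMul, dotProduct, M, hej, Pi.zero_apply] at h2
      have h3 := congrArg star h2
      rw [star_sum, star_zero] at h3
      rw [← h3]
      refine Finset.sum_congr rfl fun k _ => ?_
      rw [star_mul', ← Matrix.trace_conjTranspose, Matrix.conjTranspose_mul,
        Matrix.trace_mul_comm, smul_eq_mul]
    · refine Finset.sum_eq_zero fun k _ => ?_
      rw [eig_orth X _ _ _ _ (J_eig X _ _ (heig (e k))) (heig j), smul_zero]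
      have h4 : μ j ≤ μ ⟨m + 1, hm⟩ := hmono (by
        rw [Fin.le_def]; simp only; omega)
      have := hee k
      linarith
  have hq := q_comb X (fun k => V (e k)) (fun k => μ (e k))
    (by intro i j; rw [horth]; simp only [he]) (fun k => heig _) c
  rw [← hY] at hq
  have h0 : fn (X * Y - Y * X) = 0 := by
    rw [← fn_ct, hZ]; simp [fn]
  rw [h0] at hq
  apply hc0
  ext i
  have h5 := (Finset.sum_eq_zero_iff_of_nonneg (fun k _ =>
    mul_nonneg (Complex.normSq_nonneg (c k)) (hpos.le.trans (hee k)))).mp hq.symm i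
      (Finset.mem_univ _)
  rcases mul_eq_zero.mp h5 with h6 | h6
  · exact Complex.normSq_eq_zero.mp h6
  · have := hee i; linarith

lemma comb2 (e : Fin 2 → ℂ) : ∃ c : Fin 2 → ℂ, c ≠ 0 ∧ ∑ k, c k * e k = 0 := by
  obtain ⟨c, hc, h⟩ := Matrix.exists_mulVec_eq_zero_iff
    (M := (!![e 0, e 1; 0, 0] : Matrix (Fin 2) (Fin 2) ℂ)).mpr (by simp [Matrix.det_fin_two])
  refine ⟨c, hc, ?_⟩
  have := congrFun h 0
  simp [Matrix.mulVec, dotProduct, Fin.sum_univ_two] at this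
  rw [Fin.sum_univ_two]
  linear_combination this

lemma comb3 (e f : Fin 3 → ℂ) :
    ∃ c : Fin 3 → ℂ, c ≠ 0 ∧ ∑ k, c k * e k = 0 ∧ ∑ k, c k * f k = 0 := by
  obtain ⟨c, hc, h⟩ := Matrix.exists_mulVec_eq_zero_iff
    (M := (!![e 0, e 1, e 2; f 0, f 1, f 2; 0, 0, 0] : Matrix (Fin 3) (Fin 3) ℂ)).mpr
      (by simp [Matrix.det_fin_three])
  refine ⟨c, hc, ?_, ?_⟩
  · have := congrFun h 0
    simp [Matrix.mulVec, dotProduct, Fin.sum_univ_three] at this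
    rw [Fin.sum_univ_three]
    linear_combination this
  · have := congrFun h 1
    simp [Matrix.mulVec, dotProduct, Fin.sum_univ_three] at this
    rw [Fin.sum_univ_three]
    linear_combination this

lemma sum_normSq_pos {ι : Type*} [Fintype ι] (c : ι → ℂ) (hc : c ≠ 0) :
    0 < ∑ k, Complex.normSq (c k) := by
  obtain ⟨i, hi⟩ := Function.ne_iff.mp hc
  exact Finset.sum_pos' (fun k _ => Complex.normSq_nonneg _)
    ⟨i, Finset.mem_univ _, Complex.normSq_pos.mpr hi⟩

lemma two_le {n : ℕ} (a : Fin n → ℝ) (ha : ∀ i, 0 ≤ a i) {i j : Fin n} (hij : i ≠ j) :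
    a i + a j ≤ ∑ k, a k := by
  rw [← Finset.sum_pair hij]
  exact Finset.sum_le_sum_of_subset_of_nonneg (Finset.subset_univ _) fun k _ _ => ha k

lemma fn_conj {n : ℕ} (P Q Y : Matrix (Fin n) (Fin n) ℂ) (hP : P * Pᴴ = 1) (hQ : Q * Qᴴ = 1) :
    fn (Pᴴ * Y * Q) = fn Y := by
  rw [fn_mul_right _ _ hQ, fn_mul_left _ _ (by simpa using hP)]

lemma h_le {n : ℕ} (h : Fin n → ℝ) (w : Fin n → Fin n → ℝ) (hw : ∀ i j, 0 ≤ w i j) :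
    -(2 * ∑ i, ∑ j, h i * h j * w i j) ≤ (∑ i, h i ^ 2) * ∑ i, ∑ j, w i j := by
  rw [Finset.mul_sum, Finset.mul_sum, ← Finset.sum_neg_distrib]
  refine Finset.sum_le_sum fun i _ => ?_
  rw [Finset.mul_sum, Finset.mul_sum, ← Finset.sum_neg_distrib]
  refine Finset.sum_le_sum fun j _ => ?_
  have h1 : -(2 * (h i * h j)) ≤ ∑ i, h i ^ 2 := by
    by_cases hij : i = j
    · subst hij
      have := Finset.sum_nonneg (s := Finset.univ) fun k _ => sq_nonneg (h k)
      nlinarith [sq_nonneg (h i)]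
    · have := two_le (fun k => h k ^ 2) (fun k => sq_nonneg _) hij
      nlinarith [sq_nonneg (h i + h j)]
  nlinarith [hw i j]

lemma M_le {n : ℕ} (a : Fin n → ℝ) (ha : ∀ i, 0 ≤ a i) (ha1 : ∑ i, a i = 1) (p : Fin n)
    (hp : ∀ i, a i ≤ a p) (w : Fin n → Fin n → ℝ) (hw : ∀ i j, 0 ≤ w i j) (hwp : w p p = 0) :
    ∑ i, ∑ j, (a i + a j) * w i j ≤ ∑ i, ∑ j, w i j := by
  refine Finset.sum_le_sum fun i _ => Finset.sum_le_sum fun j _ => ?_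
  by_cases hij : i = j
  · subst hij
    by_cases hi : i = p
    · subst hi; simp [hwp]
    · have := two_le a ha hi
      nlinarith [hp i, hw i i]
  · have := two_le a ha hij
    nlinarith [hw i j]

/-- matrix entries of conjugated linear combinations -/
lemma comb_entry {n : ℕ} {ι : Type*} [Fintype ι] (P Q : Matrix (Fin n) (Fin n) ℂ)
    (F : ι → Matrix (Fin n) (Fin n) ℂ) (c : ι → ℂ) (i j : Fin n) :
    (P * (∑ k, c k • F k) * Q) i j = ∑ k, c k * (P * F k * Q) i j := by
  rw [Finset.mul_sum, Finset.sum_mul, Matrix.sum_apply]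
  refine Finset.sum_congr rfl fun k _ => ?_
  rw [Matrix.mul_smul, Matrix.smul_mul, Matrix.smul_apply, smul_eq_mul]

lemma orth_conj {n : ℕ} {ι : Type*} [DecidableEq ι] (P Q : Matrix (Fin n) (Fin n) ℂ)
    (hP : P * Pᴴ = 1) (hQ : Q * Qᴴ = 1)
    (F : ι → Matrix (Fin n) (Fin n) ℂ)
    (hF : ∀ i j, trace (F i * (F j)ᴴ) = if i = j then 1 else 0) (i j : ι) :
    trace ((Pᴴ * F i * Q) * (Pᴴ * F j * Q)ᴴ) = if i = j then 1 else 0 := by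
  rw [← hF, Matrix.conjTranspose_mul, Matrix.conjTranspose_mul, Matrix.conjTranspose_conjTranspose,
    Matrix.mul_assoc, ← Matrix.mul_assoc Q, hQ, Matrix.one_mul, Matrix.trace_mul_comm,
    Matrix.mul_assoc, ← Matrix.mul_assoc P, hP, Matrix.one_mul, Matrix.trace_mul_comm]

lemma entry_le_fn {n : ℕ} (A : Matrix (Fin n) (Fin n) ℂ) (i j : Fin n) :
    Complex.normSq (A i j) ≤ fn A := by
  refine le_trans ?_ (Finset.single_le_sum (f := fun i => ∑ j, Complex.normSq (A i j))
    (fun i _ => Finset.sum_nonneg fun j _ => Complex.normSq_nonneg _) (Finset.mem_univ i))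
  exact Finset.single_le_sum (f := fun j => Complex.normSq (A i j))
    (fun j _ => Complex.normSq_nonneg _) (Finset.mem_univ j)

lemma bessel {n : ℕ} {ι : Type*} [Fintype ι] [DecidableEq ι]
    (D : ι → Matrix (Fin n) (Fin n) ℂ)
    (hD : ∀ i j, trace (D i * (D j)ᴴ) = if i = j then 1 else 0) (i j : Fin n) :
    ∑ k, Complex.normSq (D k i j) ≤ 1 := by
  have h1 := entry_le_fn (∑ k, star (D k i j) • D k) i j
  rw [fn_comb D hD] at h1
  have h2 : (∑ k, star (D k i j) • D k) i j = ((∑ k, Complex.normSq (D k i j) : ℝ) : ℂ) := by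
    rw [Matrix.sum_apply]
    push_cast
    refine Finset.sum_congr rfl fun k _ => ?_
    rw [Matrix.smul_apply, smul_eq_mul, ← Complex.mul_conj, mul_comm]; rfl
  have h3 : ∀ k, Complex.normSq (star (D k i j)) = Complex.normSq (D k i j) :=
    fun k => Complex.normSq_conj _
  simp only [h3] at h1
  rw [h2, Complex.normSq_ofReal] at h1
  have h0 : 0 ≤ ∑ k, Complex.normSq (D k i j) :=
    Finset.sum_nonneg fun k _ => Complex.normSq_nonneg _
  by_contra hlt
  rw [not_le] at hlt
  nlinarith

lemma sum_w {n : ℕ} {ι : Type*} [Fintype ι] [DecidableEq ι]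
    (D : ι → Matrix (Fin n) (Fin n) ℂ)
    (hD : ∀ i j, trace (D i * (D j)ᴴ) = if i = j then 1 else 0) :
    ∑ i, ∑ j, ∑ k, Complex.normSq (D k i j) = Fintype.card ι := by
  have h1 : ∀ k, ∑ i, ∑ j, Complex.normSq (D k i j) = 1 := by
    intro k
    have := fn_eq (D k)
    rw [hD k k] at this
    simpa [fn] using this
  have h2 : ∀ i, ∑ j, ∑ k, Complex.normSq (D k i j) = ∑ k, ∑ j, Complex.normSq (D k i j) :=
    fun i => Finset.sum_comm
  simp only [h2]
  rw [Finset.sum_comm]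
  simp [h1]

lemma cs {ι : Type*} [Fintype ι] (c d : ι → ℂ) :
    Complex.normSq (∑ k, c k * d k) ≤
      (∑ k, Complex.normSq (c k)) * ∑ k, Complex.normSq (d k) := by
  have h1 : ‖∑ k, c k * d k‖ ≤ ∑ k, ‖c k‖ * ‖d k‖ :=
    (norm_sum_le _ _).trans (Finset.sum_le_sum fun k _ => (norm_mul _ _).le)
  have h2 := Finset.sum_mul_sq_le_sq_mul_sq Finset.univ (fun k => ‖c k‖) (fun k => ‖d k‖)
  simp only [Complex.normSq_eq_norm_sq]
  exact (pow_le_pow_left₀ (norm_nonneg _) h1 2).trans h2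

lemma row_norm {n : ℕ} (A Q : Matrix (Fin n) (Fin n) ℂ) (hQ : Q * Qᴴ = 1) (p : Fin n) :
    ∑ j, Complex.normSq ((A * Q) p j) = ∑ j, Complex.normSq (A p j) := by
  have key : ∀ B : Matrix (Fin n) (Fin n) ℂ,
      ((∑ j, Complex.normSq (B p j) : ℝ) : ℂ) = (B * Bᴴ) p p := by
    intro B
    rw [Matrix.mul_apply]
    push_cast
    exact Finset.sum_congr rfl fun j _ => (Complex.mul_conj _).symm
  have : ((∑ j, Complex.normSq ((A * Q) p j) : ℝ) : ℂ) =
      ((∑ j, Complex.normSq (A p j) : ℝ) : ℂ) := by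
    rw [key, key, Matrix.conjTranspose_mul, Matrix.mul_assoc, ← Matrix.mul_assoc Q, hQ,
      Matrix.one_mul]
  exact_mod_cast this

lemma col_norm {n : ℕ} (A P : Matrix (Fin n) (Fin n) ℂ) (hP : P * Pᴴ = 1) (p : Fin n) :
    ∑ j, Complex.normSq ((Pᴴ * A) j p) = ∑ j, Complex.normSq (A j p) := by
  have h := row_norm Aᴴ P hP p
  have h2 : Aᴴ * P = (Pᴴ * A)ᴴ := by simp
  rw [h2] at h
  simpa [Matrix.conjTranspose_apply] using h

lemma entry_ineq (s t : ℝ) (hs : 0 ≤ s) (ht : 0 ≤ t) (b c : ℂ) :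
    Complex.normSq ((s : ℂ) * b - c * t) ≤
      (s ^ 2 + s * t) * Complex.normSq b + (t ^ 2 + s * t) * Complex.normSq c := by
  have h := mul_nonneg (mul_nonneg hs ht) (Complex.normSq_nonneg (b + c))
  simp only [Complex.normSq_apply, Complex.sub_re, Complex.sub_im, Complex.mul_re, Complex.mul_im,
    Complex.ofReal_re, Complex.ofReal_im, Complex.add_re, Complex.add_im] at h ⊢
  nlinarith [h]

lemma row_col {n : ℕ} (D : Matrix (Fin n) (Fin n) ℂ) (p : Fin n) (hD : D p p = 0) :
    ∑ j, Complex.normSq (D p j) + ∑ i, Complex.normSq (D i p) ≤ fn D := by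
  have h1 : ∑ j, Complex.normSq (D p j) =
      ∑ i, ∑ j, if i = p then Complex.normSq (D i j) else 0 := by
    rw [Finset.sum_comm]; simp
  have h2 : ∑ i, Complex.normSq (D i p) =
      ∑ i, ∑ j, if j = p then Complex.normSq (D i j) else 0 := by
    simp
  rw [h1, h2, ← Finset.sum_add_distrib]
  refine Finset.sum_le_sum fun i _ => ?_
  rw [← Finset.sum_add_distrib]
  refine Finset.sum_le_sum fun j _ => ?_
  have := Complex.normSq_nonneg (D i j)
  split_ifs with hi hj
  · subst hi; subst hj; simp [hD]
  all_goals linarith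

set_option maxHeartbeats 1000000 in
lemma caseC {n : ℕ} (X U V : Matrix (Fin n) (Fin n) ℂ) (s : Fin n → ℝ)
    (hU : U * Uᴴ = 1) (hU' : Uᴴ * U = 1) (hV : V * Vᴴ = 1) (hV' : Vᴴ * V = 1)
    (hs : ∀ i, 0 ≤ s i) (hs1 : ∑ i, s i ^ 2 = 1)
    (hX : X = U * diagonal (fun i => (s i : ℂ)) * Vᴴ) (p : Fin n) (hp : 1 / 2 ≤ s p ^ 2)
    (σ : ℝ) (hσ0 : 0 ≤ σ) (hσ : σ ^ 2 = 1 - s p ^ 2)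
    (Y : Matrix (Fin n) (Fin n) ℂ) (hD : (Vᴴ * Y * U) p p = 0)
    (hBC : (Vᴴ * Y * V) p p = (Uᴴ * Y * U) p p) :
    fn (X * Y - Y * X) ≤ (1 + 2 * s p * σ) * fn Y := by
  have hσp : σ ≤ s p := by
    apply le_of_sq_le_sq _ (hs p)
    linarith
  have hsσ : ∀ i, i ≠ p → s i ≤ σ := by
    intro i hi
    apply le_of_sq_le_sq _ hσ0
    have := two_le (fun k => s k ^ 2) (fun k => sq_nonneg _) hi
    rw [hs1] at this
    linarith
  have h1 : fn (X * Y - Y * X) = fn (Uᴴ * (X * Y - Y * X) * V) := (fn_conj _ _ _ hU hV).symm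
  have h2 : Uᴴ * (X * Y - Y * X) * V = diagonal (fun i => (s i : ℂ)) * (Vᴴ * Y * V)
      - (Uᴴ * Y * U) * diagonal (fun i => (s i : ℂ)) := by
    rw [Matrix.mul_sub, Matrix.sub_mul, hX]
    congr 1
    · simp only [← Matrix.mul_assoc, hU', Matrix.one_mul]
    · simp only [Matrix.mul_assoc, hV', Matrix.mul_one]
  have hfB : fn (Vᴴ * Y * V) = fn Y := fn_conj _ _ _ hV hV
  have hfC : fn (Uᴴ * Y * U) = fn Y := fn_conj _ _ _ hU hU
  have hfD : fn (Vᴴ * Y * U) = fn Y := fn_conj _ _ _ hV hU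
  have hrow : ∑ j, Complex.normSq ((Vᴴ * Y * V) p j) = ∑ j, Complex.normSq ((Vᴴ * Y * U) p j) := by
    rw [row_norm _ _ hV, row_norm _ _ hU]
  have hcol : ∑ j, Complex.normSq ((Uᴴ * Y * U) j p) = ∑ j, Complex.normSq ((Vᴴ * Y * U) j p) := by
    rw [Matrix.mul_assoc, Matrix.mul_assoc, col_norm _ _ hU, col_norm _ _ hV]
  have hrc := row_col _ p hD
  rw [← hrow, ← hcol, hfD] at hrc
  rw [h1, h2]
  generalize Vᴴ * Y * V = B at *
  generalize Uᴴ * Y * U = C at *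
  set P := s p ^ 2 + s p * σ with hP
  set Q := σ ^ 2 + s p * σ with hQ
  have hPQ : 0 ≤ P - Q := by nlinarith [hs p]
  have hQ0 : 0 ≤ Q := by have := mul_nonneg (hs p) hσ0; positivity
  have hb : ∀ i j, Complex.normSq ((diagonal (fun i => (s i : ℂ)) * B
      - C * diagonal (fun i => (s i : ℂ))) i j) ≤
      (Q * Complex.normSq (B i j) + if i = p then (P - Q) * Complex.normSq (B i j) else 0) +
      (Q * Complex.normSq (C i j) + if j = p then (P - Q) * Complex.normSq (C i j) else 0) := by
    intro i j
    rw [Matrix.sub_apply, Matrix.diagonal_mul, Matrix.mul_diagonal]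
    have h := entry_ineq (s i) (s j) (hs i) (hs j) (B i j) (C i j)
    have hBn := Complex.normSq_nonneg (B i j)
    have hCn := Complex.normSq_nonneg (C i j)
    have hij : s i * s j = s j * s i := mul_comm _ _
    by_cases hi : i = p <;> by_cases hj : j = p
    · subst hi; subst hj
      rw [if_pos rfl, if_pos rfl, hBC, mul_comm, sub_self]
      simp only [map_zero]
      linarith [mul_nonneg hPQ hCn, mul_nonneg hQ0 hCn, mul_nonneg hPQ hBn, mul_nonneg hQ0 hBn]
    · subst hi
      rw [if_pos rfl, if_neg hj]
      have e1 : s i ^ 2 + s i * s j ≤ P := by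
        linarith [mul_le_mul_of_nonneg_left (hsσ j hj) (hs i)]
      have e2 : s j ^ 2 + s i * s j ≤ Q := by
        linarith [mul_le_mul_of_nonneg_left (hsσ j hj) (hs i),
          pow_le_pow_left₀ (hs j) (hsσ j hj) 2]
      linarith [mul_le_mul_of_nonneg_right e1 hBn, mul_le_mul_of_nonneg_right e2 hCn]
    · subst hj
      rw [if_neg hi, if_pos rfl]
      have e1 : s i ^ 2 + s i * s j ≤ Q := by
        linarith [mul_le_mul_of_nonneg_left (hsσ i hi) (hs j),
          pow_le_pow_left₀ (hs i) (hsσ i hi) 2]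
      have e2 : s j ^ 2 + s i * s j ≤ P := by
        linarith [mul_le_mul_of_nonneg_left (hsσ i hi) (hs j)]
      linarith [mul_le_mul_of_nonneg_right e1 hBn, mul_le_mul_of_nonneg_right e2 hCn]
    · rw [if_neg hi, if_neg hj]
      have e0 : s i * s j ≤ s p * σ :=
        mul_le_mul ((hsσ i hi).trans hσp) (hsσ j hj) (hs j) (hs p)
      have e1 : s i ^ 2 + s i * s j ≤ Q := by
        linarith [pow_le_pow_left₀ (hs i) (hsσ i hi) 2]
      have e2 : s j ^ 2 + s i * s j ≤ Q := by
        linarith [pow_le_pow_left₀ (hs j) (hsσ j hj) 2]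
      linarith [mul_le_mul_of_nonneg_right e1 hBn, mul_le_mul_of_nonneg_right e2 hCn]
  have hsum : fn (diagonal (fun i => (s i : ℂ)) * B - C * diagonal (fun i => (s i : ℂ))) ≤
      Q * fn B + (P - Q) * ∑ j, Complex.normSq (B p j) +
      (Q * fn C + (P - Q) * ∑ j, Complex.normSq (C j p)) := by
    refine (Finset.sum_le_sum fun i _ => Finset.sum_le_sum fun j _ => hb i j).trans (le_of_eq ?_)
    simp only [Finset.sum_add_distrib]
    congr 1
    · congr 1
      · simp only [fn, Finset.mul_sum]
      · rw [Finset.sum_comm]; simp [Finset.mul_sum]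
    · congr 1
      · simp only [fn, Finset.mul_sum]
      · simp [Finset.mul_sum]
  rw [hfB, hfC] at hsum
  have h3 := mul_le_mul_of_nonneg_left hrc hPQ
  have h4 : P + Q = 1 + 2 * s p * σ := by rw [hP, hQ, hσ]; ring
  rw [← h4]
  linarith

lemma choosec (e : Fin 4 → ℂ) : ∃ c : Fin 4 → ℂ, ∑ k, Complex.normSq (c k) = 1 ∧
    Complex.normSq (∑ k, c k * e k) = ∑ k, Complex.normSq (e k) := by
  have hS0 : 0 ≤ ∑ k, Complex.normSq (e k) := Finset.sum_nonneg fun k _ => Complex.normSq_nonneg _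
  by_cases hS : ∑ k, Complex.normSq (e k) = 0
  · have he : ∀ k, e k = 0 := fun k => Complex.normSq_eq_zero.mp
      ((Finset.sum_eq_zero_iff_of_nonneg (fun k _ => Complex.normSq_nonneg (e k))).mp hS k
        (Finset.mem_univ _))
    refine ⟨![1, 0, 0, 0], ?_, ?_⟩
    · simp [Fin.sum_univ_four]
    · simp [he]
  · obtain ⟨r, hr⟩ : ∃ r, r = Real.sqrt (∑ k, Complex.normSq (e k)) := ⟨_, rfl⟩
    have hr2 : r ^ 2 = ∑ k, Complex.normSq (e k) := by rw [hr, Real.sq_sqrt hS0]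
    have hr0 : r ≠ 0 := by
      intro h; rw [h] at hr2; apply hS; rw [← hr2]; simp
    refine ⟨fun k => ((r⁻¹ : ℝ) : ℂ) * (starRingEnd ℂ) (e k), ?_, ?_⟩
    · simp only [map_mul, Complex.normSq_ofReal, Complex.normSq_conj]
      rw [← Finset.mul_sum, ← hr2]
      field_simp
    · have : ∑ k, ((r⁻¹ : ℝ) : ℂ) * (starRingEnd ℂ) (e k) * e k = (r : ℂ) := by
        have h1 : ∀ k, ((r⁻¹ : ℝ) : ℂ) * (starRingEnd ℂ) (e k) * e k =
            ((r⁻¹ * Complex.normSq (e k) : ℝ) : ℂ) := by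
          intro k
          rw [mul_assoc, mul_comm ((starRingEnd ℂ) (e k)), Complex.mul_conj]
          push_cast; ring
        simp only [h1]
        rw [← Complex.ofReal_sum, ← Finset.mul_sum, ← hr2]
        congr 1
        field_simp
      rw [this, Complex.normSq_ofReal, ← hr2]; ring

lemma wts {n : ℕ} (D : Fin 4 → Matrix (Fin n) (Fin n) ℂ)
    (hD : ∀ i j, trace (D i * (D j)ᴴ) = if i = j then 1 else 0) (c : Fin 4 → ℂ)
    (hc : ∑ k, Complex.normSq (c k) ≤ 1) :
    (∀ i j, 0 ≤ ∑ k, Complex.normSq (D k i j) - Complex.normSq (∑ k, c k * D k i j)) ∧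
    (∀ i j, ∑ k, Complex.normSq (D k i j) - Complex.normSq (∑ k, c k * D k i j) ≤ 1) ∧
    ∑ i, ∑ j, (∑ k, Complex.normSq (D k i j) - Complex.normSq (∑ k, c k * D k i j)) =
      4 - ∑ k, Complex.normSq (c k) := by
  refine ⟨fun i j => ?_, fun i j => ?_, ?_⟩
  · have h1 := cs c (fun k => D k i j)
    have h2 : 0 ≤ ∑ k, Complex.normSq (D k i j) :=
      Finset.sum_nonneg fun k _ => Complex.normSq_nonneg _
    nlinarith
  · have h1 := bessel D hD i j
    have h2 := Complex.normSq_nonneg (∑ k, c k * D k i j)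
    linarith
  · have h1 := sum_w D hD
    have h2 := fn_comb D hD c
    simp only [Finset.sum_sub_distrib]
    rw [h1, ← h2]
    simp [fn, Matrix.sum_apply]

lemma form_sum {n : ℕ} (a : Fin n → Fin n → ℝ) (P Q : Matrix (Fin n) (Fin n) ℂ)
    (F : Fin 4 → Matrix (Fin n) (Fin n) ℂ) (c : Fin 4 → ℂ) :
    ∑ k, ∑ i, ∑ j, a i j * Complex.normSq ((P * F k * Q) i j) -
      ∑ i, ∑ j, a i j * Complex.normSq ((P * (∑ k, c k • F k) * Q) i j) =
    ∑ i, ∑ j, a i j * (∑ k, Complex.normSq ((P * F k * Q) i j) -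
      Complex.normSq (∑ k, c k * (P * F k * Q) i j)) := by
  rw [Finset.sum_comm, ← Finset.sum_sub_distrib]
  refine Finset.sum_congr rfl fun i _ => ?_
  rw [Finset.sum_comm, ← Finset.sum_sub_distrib]
  refine Finset.sum_congr rfl fun j _ => ?_
  rw [comb_entry, mul_sub, Finset.mul_sum]

lemma hL2 (a b c : ℝ) :
    2 * b * (2 * a + 2 * c) ≤ (2 * Real.sqrt 2) * (a ^ 2 + b ^ 2 + c ^ 2) := by
  obtain ⟨r, hr⟩ : ∃ r, r = Real.sqrt 2 := ⟨_, rfl⟩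
  have h : r ^ 2 = 2 := by rw [hr]; exact Real.sq_sqrt (by norm_num)
  have h0 : 0 ≤ r := by rw [hr]; exact Real.sqrt_nonneg _
  rw [← hr]
  have h1 : r * (r * a - b) ^ 2 = 2 * r * a ^ 2 - 4 * a * b + r * b ^ 2 := by
    linear_combination (r * a ^ 2 - 2 * a * b) * h
  have h2 : r * (r * c - b) ^ 2 = 2 * r * c ^ 2 - 4 * c * b + r * b ^ 2 := by
    linear_combination (r * c ^ 2 - 2 * c * b) * h
  have h3 := mul_nonneg h0 (sq_nonneg (r * a - b))
  have h4 := mul_nonneg h0 (sq_nonneg (r * c - b))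
  linarith

lemma hL1 (a b c : ℝ) :
    2 * b * (2 * a + 1 * c) ≤ (Real.sqrt 5) * (a ^ 2 + b ^ 2 + c ^ 2) := by
  obtain ⟨r, hr⟩ : ∃ r, r = Real.sqrt 5 := ⟨_, rfl⟩
  have h : r ^ 2 = 5 := by rw [hr]; exact Real.sq_sqrt (by norm_num)
  have h0 : 0 ≤ r := by rw [hr]; exact Real.sqrt_nonneg _
  rw [← hr]
  have h1 : r * (a - 2 * r * b / 5) ^ 2 = r * a ^ 2 - 4 * a * b + 4 / 5 * r * b ^ 2 := by
    linear_combination (4 / 25 * r * b ^ 2 - 4 / 5 * a * b) * h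
  have h2 : r * (c - r * b / 5) ^ 2 = r * c ^ 2 - 2 * c * b + 1 / 5 * r * b ^ 2 := by
    linear_combination (1 / 25 * r * b ^ 2 - 2 / 5 * c * b) * h
  have h3 := mul_nonneg h0 (sq_nonneg (a - 2 * r * b / 5))
  have h4 := mul_nonneg h0 (sq_nonneg (c - r * b / 5))
  linarith

lemma mainbound {n : ℕ} [NeZero n] (X U V W W' : Matrix (Fin n) (Fin n) ℂ) (s h g : Fin n → ℝ)
    (hU : U * Uᴴ = 1) (hV : V * Vᴴ = 1) (hW : W * Wᴴ = 1) (hW' : W' * W'ᴴ = 1)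
    (hs1 : ∑ i, s i ^ 2 = 1) (hhg : ∑ i, h i ^ 2 + ∑ i, g i ^ 2 = 1)
    (hq : ∀ Y, fn (X * Y - Y * X) =
        ∑ i, ∑ j, (s i ^ 2 + s j ^ 2) * Complex.normSq ((Vᴴ * Y * U) i j)
        - 2 * ∑ i, ∑ j, h i * h j * Complex.normSq ((Wᴴ * Y * W) i j)
        - 2 * ∑ i, ∑ j, g i * g j * Complex.normSq ((W'ᴴ * Y * W') i j))
    (p q : Fin n) (hpq : p ≠ q) (hp : ∀ i, s i ^ 2 ≤ s p ^ 2)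
    (hpq' : ∀ i, i ≠ p → s i ^ 2 ≤ s q ^ 2)
    (F : Fin 4 → Matrix (Fin n) (Fin n) ℂ)
    (hF : ∀ i j, trace (F i * (F j)ᴴ) = if i = j then 1 else 0) (c : Fin 4 → ℂ)
    (κ L : ℝ) (hκ : 0 < κ) (hκ2 : ∑ k, Complex.normSq (c k) = 2 - κ)
    (hc : ∑ k, Complex.normSq (c k) ≤ 1)
    (hL : ∀ a b c : ℝ, 2 * b * (2 * a + κ * c) ≤ L * (a ^ 2 + b ^ 2 + c ^ 2)) :
    ∃ θ, θ ≤ max (2 * s q ^ 2) (1 - s q ^ 2) ∧ θ ≤ s p ^ 2 + s q ^ 2 ∧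
      ∑ k, fn (X * F k - F k * X) - fn (X * (∑ k, c k • F k) - (∑ k, c k • F k) * X) ≤
        θ * (2 + κ) + (2 * s p ^ 2 - θ) * (∑ k, Complex.normSq ((Vᴴ * F k * U) p p) -
          Complex.normSq (∑ k, c k * (Vᴴ * F k * U) p p)) + 2 * (s p ^ 2 + s q ^ 2 - θ) + L := by
  obtain ⟨d0, d1, d2⟩ := wts _ (orth_conj V U hV hU F hF) c hc
  obtain ⟨e0, e1, e2⟩ := wts _ (orth_conj W W hW hW F hF) c hc
  obtain ⟨f0, f1, f2⟩ := wts _ (orth_conj W' W' hW' hW' F hF) c hc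
  have hk : (4 : ℝ) - ∑ k, Complex.normSq (c k) = 2 + κ := by rw [hκ2]; ring
  rw [hk] at d2 e2 f2
  have HW := hweights h _ e0 e1 κ L hκ e2 hL
  have HW' := hweights g _ f0 f1 κ L hκ f2 hL
  obtain ⟨θ, h1, h2, h3⟩ := Mweights (fun i => s i ^ 2) (fun i => sq_nonneg _) hs1 p q hpq hp hpq'
    _ d0 d1
  refine ⟨θ, h1, h2, ?_⟩
  rw [d2] at h3
  have E1 := form_sum (fun i j => s i ^ 2 + s j ^ 2) Vᴴ U F c
  have E2 := form_sum (fun i j => h i * h j) Wᴴ W F c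
  have E3 := form_sum (fun i j => g i * g j) W'ᴴ W' F c
  rw [← E1] at h3
  rw [← E2] at HW
  rw [← E3] at HW'
  simp only [hq, Finset.sum_sub_distrib, ← Finset.mul_sum]
  have : L * ∑ i, h i ^ 2 + L * ∑ i, g i ^ 2 = L := by rw [← mul_add, hhg, mul_one]
  linarith

/-- For a unit-norm `X`, `λ₁(T_X) + λ₃(T_X) ≤ (4 + √10)/2`, where the eigenvalues `μ`
(in decreasing order) are given via an orthonormal eigenbasis `V` of `M(n,ℂ)`. -/
theorem TX_lambda1_add_lambda3 (n : ℕ) (hn : 2 ≤ n)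
    (X : Matrix (Fin n) (Fin n) ℂ) (hX : (trace (X * Xᴴ)).re = 1)
    (μ : Fin (n * n) → ℝ) (hmono : Antitone μ)
    (V : Fin (n * n) → Matrix (Fin n) (Fin n) ℂ)
    (horth : ∀ i j, trace (V i * (V j)ᴴ) = if i = j then 1 else 0)
    (heig : ∀ i, TX X (V i) = (μ i : ℂ) • V i) :
    μ ⟨0, by nlinarith⟩ + μ ⟨2, by nlinarith⟩ ≤ (4 + Real.sqrt 10) / 2 := by
  have hN : 4 ≤ n * n := by nlinarith
  haveI : NeZero n := ⟨by omega⟩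
  have h10 : (3.1622 : ℝ) ≤ Real.sqrt 10 := Real.le_sqrt_of_sq_le (by norm_num)
  have h2 : Real.sqrt 2 ≤ 1.41425 := Real.sqrt_le_iff.mpr (by norm_num)
  have h5 : Real.sqrt 5 ≤ 2.2361 := Real.sqrt_le_iff.mpr (by norm_num)
  have m20 : μ ⟨2, by omega⟩ ≤ μ ⟨0, by omega⟩ := hmono (by simp)
  by_cases hpos : 0 < μ ⟨0, by omega⟩
  swap
  · rw [not_lt] at hpos
    linarith
  have m10 : μ ⟨1, by omega⟩ = μ ⟨0, by omega⟩ := le_antisymm (hmono (by simp))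
    (pairing X μ hmono V horth heig 0 (by decide) (by omega) hpos)
  -- restriction to initial segments
  have horthm : ∀ (m : ℕ) (hm : m ≤ n * n), ∀ i j : Fin m,
      trace (V (Fin.castLE hm i) * (V (Fin.castLE hm j))ᴴ) = if i = j then 1 else 0 := by
    intro m hm i j
    rw [horth]
    simp only [Fin.castLE_inj]
  have hqm : ∀ (m : ℕ) (hm : m ≤ n * n) (c : Fin m → ℂ),
      fn (X * (∑ k, c k • V (Fin.castLE hm k)) - (∑ k, c k • V (Fin.castLE hm k)) * X) =
      ∑ k, Complex.normSq (c k) * μ (Fin.castLE hm k) := fun m hm c =>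
    q_comb X (fun k => V (Fin.castLE hm k)) (fun k => μ (Fin.castLE hm k)) (horthm m hm)
      (fun k => heig _) c
  have hfm : ∀ (m : ℕ) (hm : m ≤ n * n) (c : Fin m → ℂ),
      fn (∑ k, c k • V (Fin.castLE hm k)) = ∑ k, Complex.normSq (c k) := fun m hm c =>
    fn_comb _ (horthm m hm) c
  obtain ⟨U, T, W, W', s, h, g, hU', hU, hT', hT, hW', hW, hW2', hW2, hs, hs1, hhg, hXe, hq⟩ :=
    decomp X (by rw [fn_eq, hX])
  obtain ⟨p, -, hp⟩ := Finset.exists_max_image Finset.univ (fun i => s i ^ 2)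
    ⟨0, Finset.mem_univ _⟩
  replace hp : ∀ i, s i ^ 2 ≤ s p ^ 2 := fun i => hp i (Finset.mem_univ _)
  have hne : (Finset.univ.erase p : Finset (Fin n)).Nonempty := by
    rw [← Finset.card_pos, Finset.card_erase_of_mem (Finset.mem_univ _), Finset.card_univ,
      Fintype.card_fin]
    omega
  obtain ⟨q, hqp, hqm'⟩ := Finset.exists_max_image _ (fun i => s i ^ 2) hne
  have hpq : p ≠ q := fun hh => (Finset.ne_of_mem_erase hqp) hh.symm
  have hpq' : ∀ i, i ≠ p → s i ^ 2 ≤ s q ^ 2 := fun i hi =>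
    hqm' i (Finset.mem_erase.mpr ⟨hi, Finset.mem_univ _⟩)
  have hxy : s p ^ 2 + s q ^ 2 ≤ 1 := by
    have := two_le (fun k => s k ^ 2) (fun k => sq_nonneg _) hpq
    rw [hs1] at this
    exact this
  -- the bound `μ 0 ≤ 2`
  have hBW : μ ⟨0, by omega⟩ ≤ 2 := by
    have hm : 2 ≤ n * n := by omega
    obtain ⟨c, hc0, hc⟩ := comb2 (fun k => (Tᴴ * V (Fin.castLE hm k) * U) p p)
    have hcpos := sum_normSq_pos c hc0
    have e1 := hqm 2 hm c
    have e2 := hfm 2 hm c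
    have e3 : (Tᴴ * (∑ k, c k • V (Fin.castLE hm k)) * U) p p = 0 := by
      rw [comb_entry]; exact hc
    generalize (∑ k, c k • V (Fin.castLE hm k)) = Y at e1 e2 e3
    have e4 := hq Y
    have b1 := M_le (fun i => s i ^ 2) (fun i => sq_nonneg _) hs1 p hp
      (fun i j => Complex.normSq ((Tᴴ * Y * U) i j)) (fun i j => Complex.normSq_nonneg _)
      (by simp only [e3, map_zero])
    have b2 := h_le h (fun i j => Complex.normSq ((Wᴴ * Y * W) i j))
      (fun i j => Complex.normSq_nonneg _)
    have b3 := h_le g (fun i j => Complex.normSq ((W'ᴴ * Y * W') i j))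
      (fun i j => Complex.normSq_nonneg _)
    have f1 := fn_conj T U Y hT hU
    have f2 := fn_conj W W Y hW hW
    have f3 := fn_conj W' W' Y hW2 hW2
    unfold fn at f1 f2 f3
    rw [f1] at b1
    rw [f2] at b2
    rw [f3] at b3
    have f4 : fn Y = ∑ i, ∑ j, Complex.normSq (Y i j) := rfl
    rw [← f4] at b1 b2 b3
    have hb : fn (X * Y - Y * X) ≤ 2 * fn Y := by
      have : (∑ i, h i ^ 2) * fn Y + (∑ i, g i ^ 2) * fn Y = fn Y := by
        rw [← add_mul, hhg, one_mul]
      linarith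
    have e5 : fn (X * Y - Y * X) = μ ⟨0, by omega⟩ * fn Y := by
      rw [e1, e2, Fin.sum_univ_two, Fin.sum_univ_two]
      have t0 : μ (Fin.castLE hm 0) = μ ⟨0, by omega⟩ := rfl
      have t1 : μ (Fin.castLE hm 1) = μ ⟨1, by omega⟩ := rfl
      rw [t0, t1, m10]; ring
    rw [e5] at hb
    rw [← e2] at hcpos
    exact le_of_mul_le_mul_right hb hcpos
  by_cases hpos2 : 0 < μ ⟨2, by omega⟩
  swap
  · rw [not_lt] at hpos2
    linarith
  have m32 : μ ⟨3, by omega⟩ = μ ⟨2, by omega⟩ := le_antisymm (hmono (by simp))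
    (pairing X μ hmono V horth heig 2 (by decide) (by omega) hpos2)
  by_cases hC : 0.91 ≤ s p ^ 2
  · -- case C
    have hm : 3 ≤ n * n := by omega
    obtain ⟨c, hc0, hc, hc'⟩ := comb3 (fun k => (Tᴴ * V (Fin.castLE hm k) * U) p p)
      (fun k => (Tᴴ * V (Fin.castLE hm k) * T) p p - (Uᴴ * V (Fin.castLE hm k) * U) p p)
    have hcpos := sum_normSq_pos c hc0
    have e1 := hqm 3 hm c
    have e2 := hfm 3 hm c
    have e3 : (Tᴴ * (∑ k, c k • V (Fin.castLE hm k)) * U) p p = 0 := by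
      rw [comb_entry]; exact hc
    have e4 : (Tᴴ * (∑ k, c k • V (Fin.castLE hm k)) * T) p p =
        (Uᴴ * (∑ k, c k • V (Fin.castLE hm k)) * U) p p := by
      rw [comb_entry, comb_entry, ← sub_eq_zero, ← Finset.sum_sub_distrib, ← hc']
      exact Finset.sum_congr rfl fun k _ => (mul_sub _ _ _).symm
    obtain ⟨σ, hσ⟩ : ∃ σ, σ = Real.sqrt (1 - s p ^ 2) := ⟨_, rfl⟩
    have hσ0 : 0 ≤ σ := hσ ▸ Real.sqrt_nonneg _
    have hσ2 : σ ^ 2 = 1 - s p ^ 2 := by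
      rw [hσ, Real.sq_sqrt]; nlinarith [sq_nonneg (s q)]
    have b := caseC X U T s hU hU' hT hT' hs hs1 hXe p (by linarith) σ hσ0 hσ2 _ e3 e4
    rw [e1, e2] at b
    have b2 : μ ⟨2, by omega⟩ * ∑ k, Complex.normSq (c k) ≤
        ∑ k, Complex.normSq (c k) * μ (Fin.castLE hm k) := by
      rw [Finset.mul_sum]
      refine Finset.sum_le_sum fun k _ => ?_
      rw [mul_comm]
      refine mul_le_mul_of_nonneg_left (hmono ?_) (Complex.normSq_nonneg _)
      rw [Fin.le_def]
      simp only [Fin.val_castLE]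
      omega
    have b3 : μ ⟨2, by omega⟩ ≤ 1 + 2 * s p * σ := le_of_mul_le_mul_right (b2.trans b) hcpos
    have b4 : s p * σ ≤ 0.2862 := by
      apply le_of_sq_le_sq _ (by norm_num)
      rw [mul_pow, hσ2]
      nlinarith [sq_nonneg (s q)]
    linarith
  rw [not_le] at hC
  have hsum4 : ∑ k : Fin 4, fn (X * V (Fin.castLE hN k) - V (Fin.castLE hN k) * X) =
      2 * (μ ⟨0, by omega⟩ + μ ⟨2, by omega⟩) := by
    have hk : ∀ k : Fin 4, fn (X * V (Fin.castLE hN k) - V (Fin.castLE hN k) * X) =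
        μ (Fin.castLE hN k) := by
      intro k
      have := hqm 4 hN (Pi.single k 1)
      simpa [Pi.single_apply] using this
    simp only [hk]
    rw [Fin.sum_univ_four]
    have t0 : μ (Fin.castLE hN 0) = μ ⟨0, by omega⟩ := rfl
    have t1 : μ (Fin.castLE hN 1) = μ ⟨1, by omega⟩ := rfl
    have t2 : μ (Fin.castLE hN 2) = μ ⟨2, by omega⟩ := rfl
    have t3 : μ (Fin.castLE hN 3) = μ ⟨3, by omega⟩ := rfl
    rw [t0, t1, t2, t3, m10, m32]; ring
  by_cases hA : s p ^ 2 ≤ 0.77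
  · -- case A
    obtain ⟨θ, k1, k2, k3⟩ := mainbound X U T W W' s h g hU hT hW hW2 hs1 hhg hq p q hpq hp hpq'
      (fun k => V (Fin.castLE hN k)) (horthm 4 hN) 0 2 _ (by norm_num) (by simp) (by simp) hL2
    have hb := bessel _ (orth_conj T U hT hU _ (horthm 4 hN)) p p
    rw [hsum4] at k3
    have z : fn (X * (∑ k : Fin 4, (0 : Fin 4 → ℂ) k • V (Fin.castLE hN k)) -
      (∑ k : Fin 4, (0 : Fin 4 → ℂ) k • V (Fin.castLE hN k)) * X) = 0 := by simp [fn]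
    rw [z] at k3
    simp only [Pi.zero_apply, zero_mul, Finset.sum_const_zero, map_zero, sub_zero] at k3
    have hθ : 0 ≤ 2 * s p ^ 2 - θ := by have := hp q; linarith
    have k4 := mul_le_mul_of_nonneg_left hb hθ
    rcases le_max_iff.mp k1 with k5 | k5 <;> linarith
  · -- case B
    rw [not_le] at hA
    obtain ⟨c, hc1, hc⟩ := choosec (fun k => (Tᴴ * V (Fin.castLE hN k) * U) p p)
    obtain ⟨θ, k1, k2, k3⟩ := mainbound X U T W W' s h g hU hT hW hW2 hs1 hhg hq p q hpq hp hpq'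
      (fun k => V (Fin.castLE hN k)) (horthm 4 hN) c 1 _ (by norm_num) (by rw [hc1]; norm_num)
      hc1.le hL1
    rw [hsum4] at k3
    rw [hc, sub_self, mul_zero, hqm 4 hN c] at k3
    have b2 : ∑ k, Complex.normSq (c k) * μ (Fin.castLE hN k) ≤ 2 := by
      have : ∑ k, Complex.normSq (c k) * μ (Fin.castLE hN k) ≤ ∑ k, Complex.normSq (c k) * 2 := by
        refine Finset.sum_le_sum fun k _ => mul_le_mul_of_nonneg_left ?_ (Complex.normSq_nonneg _)
        exact (hmono (by rw [Fin.le_def]; simp)).trans hBW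
      rw [← Finset.sum_mul, hc1] at this
      linarith
    rcases le_max_iff.mp k1 with k5 | k5 <;> linarith
end

section
/- For any complex n×n matrix X with ‖X‖ = 1 and any k with 1 ≤ k ≤ n²/2, the sum of the 2k largest eigenvalues of T_X(Y) = [X*,[X,Y]] satisfies ∑_{i=1}^{2k} λ_i(T_X) ≤ 2k + 1 + 2√k. -/
open Matrix

namespace TXaux

lemma spec {n : ℕ} (A : Matrix (Fin n) (Fin n) ℂ) (hA : A.IsHermitian) :
    ∃ (U : Matrix (Fin n) (Fin n) ℂ) (d : Fin n → ℝ), U * Uᴴ = 1 ∧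
      A = U * diagonal (fun i => (d i : ℂ)) * Uᴴ := by
  refine ⟨hA.eigenvectorUnitary, hA.eigenvalues, ?_, ?_⟩
  · exact Unitary.coe_mul_star_self hA.eigenvectorUnitary
  · have h := hA.spectral_theorem
    rw [Unitary.conjStarAlgAut_apply] at h
    exact h

lemma trace_diag {n : ℕ} (W : Matrix (Fin n) (Fin n) ℂ) (d e : Fin n → ℝ) :
    trace (diagonal (fun i => (d i : ℂ)) * W * diagonal (fun i => (e i : ℂ)) * Wᴴ)
      = ((∑ p, ∑ q, d p * e q * ‖W p q‖ ^ 2 : ℝ) : ℂ) := by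
  push_cast
  simp only [trace, diag]
  refine Finset.sum_congr rfl fun p _ => ?_
  rw [mul_apply]
  refine Finset.sum_congr rfl fun q _ => ?_
  rw [mul_diagonal, diagonal_mul, conjTranspose_apply, ← Complex.mul_conj']
  simp only [RCLike.star_def]
  ring

lemma trace_conj {n : ℕ} (U U' V D E : Matrix (Fin n) (Fin n) ℂ) :
    trace ((U * D * Uᴴ) * V * (U' * E * U'ᴴ) * Vᴴ)
      = trace (D * (Uᴴ * V * U') * E * (Uᴴ * V * U')ᴴ) := by
  simp only [conjTranspose_mul, conjTranspose_conjTranspose, Matrix.mul_assoc]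
  rw [trace_mul_comm U]
  simp only [Matrix.mul_assoc]

/-- the weights -/
lemma weights {n m : ℕ} (V : Fin m → Matrix (Fin n) (Fin n) ℂ)
    (horth : ∀ i j, trace (V i * (V j)ᴴ) = if i = j then 1 else 0)
    (U U' : Matrix (Fin n) (Fin n) ℂ) (hU : U * Uᴴ = 1) (hU' : U' * U'ᴴ = 1) :
    ∃ c : Fin n → Fin n → ℝ, (∀ p q, 0 ≤ c p q) ∧ (∀ p q, c p q ≤ 1) ∧
      (∑ p, ∑ q, c p q = m) ∧ ∀ d e : Fin n → ℝ,
      ∑ i, (trace ((U * diagonal (fun i => (d i : ℂ)) * Uᴴ) * V i *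
        (U' * diagonal (fun i => (e i : ℂ)) * U'ᴴ) * (V i)ᴴ)).re
        = ∑ p, ∑ q, d p * e q * c p q := by
  have key : ∀ d e : Fin n → ℝ,
      ∑ i, (trace ((U * diagonal (fun i => (d i : ℂ)) * Uᴴ) * V i *
        (U' * diagonal (fun i => (e i : ℂ)) * U'ᴴ) * (V i)ᴴ)).re
        = ∑ p, ∑ q, d p * e q * ∑ i, ‖(Uᴴ * V i * U') p q‖ ^ 2 := by
    intro d e
    simp only [trace_conj, trace_diag, Complex.ofReal_re, Finset.mul_sum]
    rw [Finset.sum_comm]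
    refine Finset.sum_congr rfl fun p _ => ?_
    rw [Finset.sum_comm]
  refine ⟨fun p q => ∑ i, ‖(Uᴴ * V i * U') p q‖ ^ 2, fun p q => by positivity, ?_, ?_, key⟩
  · let w : Fin m → EuclideanSpace ℂ (Fin n × Fin n) :=
      fun i => WithLp.toLp 2 (fun pq => (Uᴴ * V i * U') pq.1 pq.2)
    have hw : Orthonormal ℂ w := by
      rw [orthonormal_iff_ite]
      intro i j
      have h1 : inner ℂ (w i) (w j) = trace ((Uᴴ * V j * U') * (Uᴴ * V i * U')ᴴ) := by
        simp only [w, PiLp.inner_apply, Fintype.sum_prod_type, trace, diag]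
        refine Finset.sum_congr rfl fun p _ => ?_
        rw [mul_apply]
        rfl
      rw [h1]
      have h3 : trace ((Uᴴ * V j * U') * (Uᴴ * V i * U')ᴴ) = trace (V j * (V i)ᴴ) := by
        simp only [conjTranspose_mul, conjTranspose_conjTranspose, Matrix.mul_assoc]
        rw [← Matrix.mul_assoc U', hU', trace_mul_comm]
        simp only [Matrix.mul_assoc, Matrix.one_mul]
        rw [hU, Matrix.mul_one]
      rw [h3, horth]
      simp [eq_comm]
    intro p q
    have := hw.sum_inner_products_le (x := EuclideanSpace.single (p, q) (1 : ℂ)) (s := Finset.univ)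
    simpa [w, EuclideanSpace.inner_single_right] using this
  · have h := key (fun _ => 1) (fun _ => 1)
    simp only [one_mul] at h
    rw [← h]
    simp [hU, hU', horth]

open scoped ComplexOrder in
lemma partP {n m : ℕ} (V : Fin m → Matrix (Fin n) (Fin n) ℂ)
    (horth : ∀ i j, trace (V i * (V j)ᴴ) = if i = j then 1 else 0)
    (X : Matrix (Fin n) (Fin n) ℂ) (hX : (trace (X * Xᴴ)).re = 1) :
    ∑ i, ((trace (Xᴴ * X * V i * (V i)ᴴ)).re + (trace (V i * (X * Xᴴ) * (V i)ᴴ)).re) ≤ m + 1 := by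
  have hH := posSemidef_conjTranspose_mul_self X
  have hK := posSemidef_self_mul_conjTranspose X
  have nn : ∀ (U : Matrix (Fin n) (Fin n) ℂ) (d : Fin n → ℝ) (A : Matrix (Fin n) (Fin n) ℂ),
      U * Uᴴ = 1 → A.PosSemidef → A = U * diagonal (fun i => (d i : ℂ)) * Uᴴ →
      (trace A).re = 1 → (∀ i, 0 ≤ d i) ∧ ∑ i, d i = 1 := by
    intro U d A hU hA h ht
    have hU2 : Uᴴ * U = 1 := mul_eq_one_comm.mp hU
    constructor
    · have h1 := hA.conjTranspose_mul_mul_same U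
      have h2 : Uᴴ * A * U = diagonal (fun i => (d i : ℂ)) := by
        rw [h]
        calc _ = (Uᴴ * U) * diagonal (fun i => (d i : ℂ)) * (Uᴴ * U) := by
              simp only [Matrix.mul_assoc]
          _ = _ := by simp [hU2]
      rw [h2, posSemidef_diagonal_iff] at h1
      intro i
      simpa using h1 i
    · rw [h, trace_mul_comm, ← Matrix.mul_assoc, hU2, Matrix.one_mul, trace_diagonal] at ht
      simpa using ht
  obtain ⟨U, d, hU, hd⟩ := spec _ hH.1
  obtain ⟨U', e, hU', he⟩ := spec _ hK.1
  obtain ⟨d0, d1⟩ := nn U d _ hU hH hd (by rw [trace_mul_comm]; exact hX)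
  obtain ⟨e0, e1⟩ := nn U' e _ hU' hK he hX
  obtain ⟨c, c0, c1, cs, hc⟩ := weights V horth U U' hU hU'
  have s1 := hc d (fun _ => 1)
  have s2 := hc (fun _ => 1) e
  simp only [Complex.ofReal_one, diagonal_one, Matrix.mul_one, hU', hU, Matrix.one_mul] at s1 s2
  rw [← hd] at s1
  rw [← he] at s2
  rw [Finset.sum_add_distrib, s1, s2]
  -- rewrite as double weighted average
  have t1 : ∑ p, ∑ q, d p * 1 * c p q = ∑ p, ∑ q, d p * e q * ∑ q', c p q' := by
    refine Finset.sum_congr rfl fun p _ => ?_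
    rw [← Finset.sum_mul, ← Finset.mul_sum, ← Finset.mul_sum, e1]
  have t2 : ∑ p, ∑ q, 1 * e q * c p q = ∑ p, ∑ q, d p * e q * ∑ p', c p' q := by
    rw [Finset.sum_comm, Finset.sum_comm (f := fun p q => d p * e q * ∑ p', c p' q)]
    refine Finset.sum_congr rfl fun q _ => ?_
    rw [← Finset.sum_mul, ← Finset.mul_sum, ← Finset.sum_mul, d1]
  have t3 : ∑ p, ∑ q, d p * e q * ((m : ℝ) + 1) = m + 1 := by
    simp only [← Finset.sum_mul, ← Finset.mul_sum, d1, e1]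
    ring
  rw [t1, t2, ← t3, ← Finset.sum_add_distrib]
  refine Finset.sum_le_sum fun p _ => ?_
  rw [← Finset.sum_add_distrib]
  refine Finset.sum_le_sum fun q _ => ?_
  rw [← mul_add]
  refine mul_le_mul_of_nonneg_left ?_ (mul_nonneg (d0 p) (e0 q))
  have u1 : ∑ p', c p' q = c p q + ∑ p' ∈ Finset.univ.erase p, c p' q :=
    (Finset.add_sum_erase _ _ (Finset.mem_univ p)).symm
  have u2 : ∑ p', ∑ q', c p' q' = ∑ q', c p q' + ∑ p' ∈ Finset.univ.erase p, ∑ q', c p' q' :=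
    (Finset.add_sum_erase _ _ (Finset.mem_univ p)).symm
  have u3 : ∑ p' ∈ Finset.univ.erase p, c p' q ≤ ∑ p' ∈ Finset.univ.erase p, ∑ q', c p' q' :=
    Finset.sum_le_sum fun p' _ =>
      Finset.single_le_sum (f := fun q' => c p' q') (fun q' _ => c0 p' q') (Finset.mem_univ q)
  have := c1 p q
  linarith

lemma partQ {n k : ℕ} (V : Fin (2 * k) → Matrix (Fin n) (Fin n) ℂ)
    (horth : ∀ i j, trace (V i * (V j)ᴴ) = if i = j then 1 else 0)
    (A : Matrix (Fin n) (Fin n) ℂ) (hA : A.IsHermitian) :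
    -∑ i, (trace (A * V i * A * (V i)ᴴ)).re ≤ Real.sqrt k * (trace (A * A)).re := by
  obtain ⟨U, a, hU, ha⟩ := spec _ hA
  have hU2 : Uᴴ * U = 1 := mul_eq_one_comm.mp hU
  obtain ⟨c, c0, c1, cs, hc⟩ := weights V horth U U hU hU
  have s := hc a a
  rw [← ha] at s
  have ht : (trace (A * A)).re = ∑ p, a p ^ 2 := by
    have : trace (A * A) = trace (diagonal (fun i => (a i : ℂ)) * diagonal (fun i => (a i : ℂ))) := by
      rw [ha]
      simp only [Matrix.mul_assoc]
      rw [trace_mul_comm U]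
      simp only [Matrix.mul_assoc]
      rw [hU2, ← Matrix.mul_assoc Uᴴ, hU2]
      simp
    rw [this, diagonal_mul_diagonal, trace_diagonal]
    simp [pow_two]
  rw [s, ht]
  set P := ∑ p, (max (a p) 0) ^ 2 with hP
  set N := ∑ p, (max (-a p) 0) ^ 2 with hN
  have hPN : ∑ p, a p ^ 2 = P + N := by
    rw [hP, hN, ← Finset.sum_add_distrib]
    refine Finset.sum_congr rfl fun p _ => ?_
    rcases le_total 0 (a p) with h | h
    · rw [max_eq_left h, max_eq_right (by linarith)]; ring
    · rw [max_eq_right h, max_eq_left (by linarith)]; ring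
  have P0 : 0 ≤ P := by positivity
  have N0 : 0 ≤ N := by positivity
  let g : Fin n → Fin n → ℝ := fun p q => max (a p) 0 * max (-a q) 0 + max (-a p) 0 * max (a q) 0
  have hg : ∀ p q, -(a p * a q) ≤ g p q := by
    intro p q
    simp only [g]
    rcases le_total 0 (a p) with h | h <;> rcases le_total 0 (a q) with h' | h' <;>
      simp only [h, h', max_eq_left, max_eq_right, Left.neg_nonpos_iff, Left.nonneg_neg_iff] <;>
      nlinarith
  have hg2 : ∑ p, ∑ q, g p q ^ 2 = 2 * P * N := by
    have : ∀ p q, g p q ^ 2 = max (a p) 0 ^ 2 * max (-a q) 0 ^ 2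
        + max (-a p) 0 ^ 2 * max (a q) 0 ^ 2 := by
      intro p q
      have : max (a p) 0 * max (-a p) 0 = 0 := by
        rcases le_total 0 (a p) with h | h
        · rw [max_eq_right (a := -a p) (by linarith)]; ring
        · rw [max_eq_right h]; ring
      simp only [g]
      linear_combination 2 * max (-a q) 0 * max (a q) 0 * this
    simp only [this, Finset.sum_add_distrib, ← Finset.mul_sum, ← Finset.sum_mul]
    rw [← hP, ← hN]; ring
  have step1 : -∑ p, ∑ q, a p * a q * c p q ≤ ∑ p, ∑ q, g p q * c p q := by
    simp only [← Finset.sum_neg_distrib]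
    refine Finset.sum_le_sum fun p _ => Finset.sum_le_sum fun q _ => ?_
    have := mul_le_mul_of_nonneg_right (hg p q) (c0 p q)
    linarith
  refine step1.trans ?_
  have cs2 := Finset.sum_mul_sq_le_sq_mul_sq Finset.univ
    (fun x : Fin n × Fin n => g x.1 x.2) (fun x => c x.1 x.2)
  simp only [Fintype.sum_prod_type] at cs2
  rw [hg2] at cs2
  have cc : ∑ p, ∑ q, c p q ^ 2 ≤ 2 * k := by
    have : ∑ p, ∑ q, c p q ^ 2 ≤ ∑ p, ∑ q, c p q :=
      Finset.sum_le_sum fun p _ => Finset.sum_le_sum fun q _ => by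
        nlinarith [c0 p q, c1 p q]
    rw [cs] at this
    exact_mod_cast this
  rw [hPN]
  refine abs_le_of_sq_le_sq' ?_ (by positivity) |>.2
  rw [mul_pow, Real.sq_sqrt (by positivity)]
  have hk0 : (0 : ℝ) ≤ k := by positivity
  have : 2 * P * N * ∑ p, ∑ q, c p q ^ 2 ≤ 2 * P * N * (2 * k) :=
    mul_le_mul_of_nonneg_left cc (by positivity)
  nlinarith [mul_nonneg hk0 (sq_nonneg (P - N))]

end TXaux

/-- For a unit-norm `X`, the sum of the `2k` largest eigenvalues of `T_X` is at most
`2k + 1 + 2√k`, where the eigenvalues `μ` (in decreasing order) are given via an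
orthonormal eigenbasis `V` of `M(n,ℂ)`. -/
theorem TX_partial_eigenvalue_sum (n k : ℕ) (hk : 1 ≤ k) (hk2 : 2 * k ≤ n * n)
    (X : Matrix (Fin n) (Fin n) ℂ) (hX : (trace (X * Xᴴ)).re = 1)
    (μ : Fin (n * n) → ℝ) (hmono : Antitone μ)
    (V : Fin (n * n) → Matrix (Fin n) (Fin n) ℂ)
    (horth : ∀ i j, trace (V i * (V j)ᴴ) = if i = j then 1 else 0)
    (heig : ∀ i, TX X (V i) = (μ i : ℂ) • V i) :
    ∑ i : Fin (2 * k), μ (Fin.castLE hk2 i) ≤ 2 * k + 1 + 2 * Real.sqrt k := by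
  set W : Fin (2 * k) → Matrix (Fin n) (Fin n) ℂ := fun i => V (Fin.castLE hk2 i) with hW
  have hWo : ∀ i j, trace (W i * (W j)ᴴ) = if i = j then 1 else 0 := by
    intro i j
    simp only [hW, horth, Fin.castLE_inj]
  set A := X + Xᴴ with hA
  set B := Complex.I • (X - Xᴴ) with hB
  have hAh : A.IsHermitian := by
    simp [hA, Matrix.IsHermitian, add_comm]
  have hBh : B.IsHermitian := by
    simp [hB, Matrix.IsHermitian, conjTranspose_smul, ← smul_neg]
  have p := TXaux.partP W hWo X hX
  have qA := TXaux.partQ W hWo A hAh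
  have qB := TXaux.partQ W hWo B hBh
  have hAB : (trace (A * A)).re + (trace (B * B)).re = 4 := by
    have : A * A + B * B = (2 : ℂ) • (X * Xᴴ) + (2 : ℂ) • (Xᴴ * X) := by
      simp only [hA, hB, smul_mul_smul_comm, Complex.I_mul_I, two_smul, neg_smul, one_smul]
      noncomm_ring
    rw [← Complex.add_re, ← trace_add, this, trace_add, trace_smul, trace_smul, trace_mul_comm Xᴴ X]
    simp [hX]; norm_num
  have hμ : ∀ i : Fin (2 * k), μ (Fin.castLE hk2 i) =
      ((trace (Xᴴ * X * W i * (W i)ᴴ)).re + (trace (W i * (X * Xᴴ) * (W i)ᴴ)).re)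
      - ((trace (A * W i * A * (W i)ᴴ)).re + (trace (B * W i * B * (W i)ᴴ)).re) / 2 := by
    intro i
    have h1 : trace (TX X (W i) * (W i)ᴴ) = (μ (Fin.castLE hk2 i) : ℂ) := by
      simp only [hW, heig, smul_mul_assoc, trace_smul, horth]
      simp
    have h2 : A * W i * A * (W i)ᴴ + B * W i * B * (W i)ᴴ
        = (2 : ℂ) • (Xᴴ * X * W i * (W i)ᴴ + W i * (X * Xᴴ) * (W i)ᴴ - TX X (W i) * (W i)ᴴ) := by
      simp only [hA, hB, TX, smul_mul_assoc, mul_smul_comm, smul_smul, Complex.I_mul_I, two_smul,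
        neg_smul, one_smul]
      noncomm_ring
    have h3 := congrArg (fun M => (trace M).re) h2
    simp only [trace_add, trace_smul, trace_sub, h1, Complex.add_re, smul_eq_mul, Complex.mul_re,
      Complex.sub_re, Complex.ofReal_re, Complex.re_ofNat, Complex.im_ofNat] at h3
    linarith
  rw [Finset.sum_congr rfl fun i _ => hμ i, Finset.sum_sub_distrib, ← Finset.sum_div,
    Finset.sum_add_distrib (f := fun i => (trace (A * W i * A * (W i)ᴴ)).re)]
  push_cast at p
  have : Real.sqrt k * (trace (A * A)).re + Real.sqrt k * (trace (B * B)).re = Real.sqrt k * 4 := by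
    rw [← mul_add, hAB]
  linarith
end
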